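/- arXiv:1504.04955 — 4 statements merged into one kernel-verified Lean document; each statement's English description precedes it below -/
import Mathlib

section
/- Symmetry of information: there exists a constant c such that for all binary strings x and y, |K(x, y) − (K(x|y) + K(y))| ≤ c·(log₂(K(x) + 2) + log₂(K(y) + 2)). -/
/-- Plain Kolmogorov complexity of `x` with respect to decompressor `D`. -/
noncomputable def Kc (D : List Bool →. List Bool) (x : List Bool) : ℕ∞ :=
  sInf {n : ℕ∞ | ∃ p : List Bool, x ∈ D p ∧ (p.length : ℕ∞) = n}

/-- `U` is an optimal decompressor. -/
def OptimalDecompressor (U : List Bool →. List Bool) : Prop :=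
  Partrec U ∧ ∀ D : List Bool →. List Bool, Partrec D →
    ∃ c : ℕ, ∀ x : List Bool, Kc U x ≤ Kc D x + (c : ℕ∞)

/-- Conditional Kolmogorov complexity of `x` given `y` with respect to `D`. -/
noncomputable def KcCond (D : List Bool × List Bool →. List Bool)
    (x y : List Bool) : ℕ∞ :=
  sInf {n : ℕ∞ | ∃ p : List Bool, x ∈ D (p, y) ∧ (p.length : ℕ∞) = n}

/-- `U₂` is an optimal conditional decompressor. -/
def OptimalCondDecompressor (U₂ : List Bool × List Bool →. List Bool) : Prop :=
  Partrec U₂ ∧ ∀ D : List Bool × List Bool →. List Bool, Partrec D →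
    ∃ c : ℕ, ∀ x y : List Bool, KcCond U₂ x y ≤ KcCond D x y + (c : ℕ∞)

open Encodable

section BinaryStrings

/-- The number whose little-endian binary expansion is the given string. -/
def binVal (l : List Bool) : ℕ := l.foldr (fun b v => 2 * v + b.toNat) 0

theorem binVal_cons (b : Bool) (l : List Bool) : binVal (b :: l) = 2 * binVal l + b.toNat := rfl

theorem primrec_binVal : Primrec binVal := by
  refine Primrec.list_foldr (f := id)
    (h := fun (_ : List Bool) (q : Bool × ℕ) => 2 * q.2 + q.1.toNat)
    .id (.const 0) ?_
  exact Primrec.nat_add.comp₂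
    (Primrec.nat_double.comp₂ (Primrec.snd.comp₂ Primrec₂.right))
    ((Primrec.dom_finite Bool.toNat).comp₂ (Primrec.fst.comp₂ Primrec₂.right))

theorem exists_binVal_eq : ∀ {k n : ℕ}, n < 2 ^ k → ∃ l : List Bool, l.length = k ∧ binVal l = n
  | 0, n, h => ⟨[], rfl, by simp at h; simp [h, binVal]⟩
  | k + 1, n, h => by
    obtain ⟨l, hl, hv⟩ := exists_binVal_eq (k := k) (n := n / 2) (by rw [pow_succ] at h; omega)
    refine ⟨decide (n % 2 = 1) :: l, by simp [hl], ?_⟩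
    rw [binVal_cons, hv]
    rcases Nat.mod_two_eq_zero_or_one n with h | h <;> simp [h] <;> omega

/-- Split a string into a number, stored in a self-delimiting header, and the remaining string. -/
def splitHeader (p : List Bool) : ℕ × List Bool :=
  (binVal ((p.drop (p.idxOf false + 1)).take (p.idxOf false)),
    (p.drop (p.idxOf false + 1)).drop (p.idxOf false))

theorem computable_splitHeader : Computable splitHeader := by
  have hk : Primrec fun p : List Bool => p.idxOf false :=
    Primrec.list_idxOf.comp (Primrec.const false) Primrec.id
  have h : Primrec fun p : List Bool => p.drop (p.idxOf false + 1) :=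
    Primrec.list_drop.comp (Primrec.succ.comp hk) Primrec.id
  exact ((primrec_binVal.comp (Primrec.list_take.comp hk h)).pair
    (Primrec.list_drop.comp hk h)).to_comp

theorem exists_splitHeader_eq (n : ℕ) (r : List Bool) :
    ∃ p, splitHeader p = (n, r) ∧ p.length = r.length + 2 * Nat.log 2 n + 3 := by
  obtain ⟨l, hl, rfl⟩ := exists_binVal_eq (Nat.lt_pow_succ_log_self one_lt_two n)
  refine ⟨List.replicate l.length true ++ false :: (l ++ r), ?_, ?_⟩
  · have : (List.replicate l.length true ++ false :: (l ++ r)).drop (l.length + 1) = l ++ r := by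
      simp [List.drop_append]
    have hk : (List.replicate l.length true ++ false :: (l ++ r)).idxOf false = l.length := by
      simp [List.idxOf_append]
    simp [splitHeader, hk, this]
  · simp [Nat.succ_eq_add_one] at hl ⊢
    omega

end BinaryStrings

section Enumeration

variable {α β γ : Type*} [Primcodable α] [Primcodable β] [Primcodable γ] [DecidableEq β]

/-- The list without repetitions, in order of appearance, of those `z` for which a witness `w` with
`T (w, z)` is found among the first `s` candidates. -/
def enumStage (T : γ × β → Bool) : ℕ → List β
  | 0 => []
  | s + 1 => ((decode (α := γ × β) s).map fun q =>
      bif T q && decide (List.length (enumStage T s) ≤ (enumStage T s).idxOf q.2)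
      then enumStage T s ++ [q.2] else enumStage T s).getD (enumStage T s)

theorem enumStage_succ_eq (T : γ × β → Bool) (s : ℕ) :
    enumStage T (s + 1) = enumStage T s ∨
      ∃ q, decode s = some q ∧ T q = true ∧ q.2 ∉ enumStage T s ∧
        enumStage T (s + 1) = enumStage T s ++ [q.2] := by
  rw [enumStage]
  rcases decode (α := γ × β) s with _ | q
  · simp
  by_cases h : T q = true ∧ q.2 ∉ enumStage T s
  · refine .inr ⟨q, rfl, h.1, h.2, ?_⟩
    simp [h.1, List.idxOf_eq_length h.2]
  · left
    by_cases hT : T q = true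
    · have := List.idxOf_lt_length_of_mem (not_not.1 fun hn => h ⟨hT, hn⟩)
      simp [Nat.not_le.2 this]
    · simp [hT]

theorem enumStage_mono (T : γ × β → Bool) {s t : ℕ} (h : s ≤ t) :
    enumStage T s <+: enumStage T t := by
  induction t, h using Nat.le_induction with
  | base => exact List.prefix_rfl
  | succ t _ ih =>
    refine ih.trans ?_
    rcases enumStage_succ_eq T t with h | ⟨q, -, -, -, h⟩ <;> simp [h]

theorem enumStage_nodup (T : γ × β → Bool) (s : ℕ) : (enumStage T s).Nodup := by
  induction s with
  | zero => simp [enumStage]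
  | succ s ih =>
    rcases enumStage_succ_eq T s with h | ⟨q, -, -, hq, h⟩ <;> rw [h]
    · exact ih
    · exact List.nodup_append.2 ⟨ih, by simp, by simpa using fun a ha (e : a = q.2) => hq (e ▸ ha)⟩

theorem exists_of_mem_enumStage {T : γ × β → Bool} {s : ℕ} {z : β} (hz : z ∈ enumStage T s) :
    ∃ w, T (w, z) = true := by
  induction s with
  | zero => simp [enumStage] at hz
  | succ s ih =>
    rcases enumStage_succ_eq T s with h | ⟨q, -, hT, -, h⟩ <;> rw [h] at hz
    · exact ih hz
    · rcases List.mem_append.1 hz with hz | hz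
      · exact ih hz
      · obtain rfl := List.mem_singleton.1 hz
        exact ⟨q.1, hT⟩

theorem exists_mem_enumStage {T : γ × β → Bool} {w : γ} {z : β} (h : T (w, z) = true) :
    ∃ s, z ∈ enumStage T s := by
  refine ⟨encode (w, z) + 1, ?_⟩
  rw [enumStage]
  by_cases hz : z ∈ enumStage T (encode (w, z))
  · simp [-encode_prod_val, h, Nat.not_le.2 (List.idxOf_lt_length_of_mem hz), hz]
  · simp [-encode_prod_val, h, List.idxOf_eq_length hz]

theorem computable_enumStage {T : α → γ × β → Bool} (hT : Computable₂ T) :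
    Computable₂ fun a s => enumStage (T a) s := by
  have hL : Computable fun x : ((α × ℕ) × ℕ × List β) × γ × β => x.1.2.2 :=
    Computable.snd.comp (Computable.snd.comp Computable.fst)
  have hz : Computable fun x : ((α × ℕ) × ℕ × List β) × γ × β => x.2.2 :=
    Computable.snd.comp Computable.snd
  have hstep : Computable₂ fun (x : α × ℕ) (y : ℕ × List β) =>
      ((decode (α := γ × β) y.1).map fun q =>
        bif T x.1 q && decide (List.length y.2 ≤ y.2.idxOf q.2)
        then y.2 ++ [q.2] else y.2).getD y.2 := by
    refine Computable.option_getD (Computable.option_map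
      (Computable.decode.comp (Computable.fst.comp Computable.snd)) ?_)
      (Computable.snd.comp Computable.snd)
    refine Computable.cond (Primrec.and.to_comp.comp
      (hT.comp (Computable.fst.comp (Computable.fst.comp Computable.fst)) Computable.snd)
      (Primrec.nat_le.decide.to_comp.comp (Computable.list_length.comp hL)
        (Primrec.list_idxOf.to_comp.comp hz hL)))
      (Computable.list_concat.comp hL hz) hL
  refine (Computable.nat_rec Computable.snd (Computable.const []) hstep).to₂.of_eq fun x => ?_
  obtain ⟨a, s⟩ := x
  induction s with
  | zero => rfl
  | succ s ih =>
    simp only [enumStage] at ih ⊢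
    rw [← ih]

/-- Enumeration by index: if candidates `z` are semi-decided by `T a`, the `i`-th one found can be
computed from `a` and `i`. -/
def enumNth (T : γ × β → Bool) (i : ℕ) : Part β :=
  Nat.rfindOpt fun s => (enumStage T s)[i]?

theorem partrec_enumNth {T : α → γ × β → Bool} (hT : Computable₂ T) :
    Partrec₂ fun a i => enumNth (T a) i :=
  (Partrec.rfindOpt (Computable.list_getElem?.comp₂
    ((computable_enumStage hT).comp₂ (Computable.fst.comp₂ (Computable.fst.to₂))
      (Computable.snd.to₂)) (Computable.snd.comp₂ (Computable.fst.to₂)))).to₂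

theorem exists_mem_enumNth {T : γ × β → Bool} {w : γ} {z : β} {N : ℕ} (h : T (w, z) = true)
    (hN : ∀ s, (enumStage T s).length ≤ N) : ∃ i < N, z ∈ enumNth T i := by
  obtain ⟨s, hs⟩ := exists_mem_enumStage h
  obtain ⟨i, hi, rfl⟩ := List.getElem_of_mem hs
  refine ⟨i, hi.trans_le (hN s), (Nat.rfindOpt_mono ?_).2 ⟨s, by simp [hi]⟩⟩
  intro a m n hmn ha
  obtain ⟨l, hl⟩ := enumStage_mono T hmn
  obtain ⟨hi, rfl⟩ := List.getElem?_eq_some_iff.1 ha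
  rw [← hl, List.getElem?_append_left hi]
  exact ha

end Enumeration

section Kolmogorov

theorem Kc_le_of_mem {D : List Bool →. List Bool} {p x : List Bool} (h : x ∈ D p) :
    Kc D x ≤ p.length :=
  sInf_le ⟨p, h, rfl⟩

theorem exists_program_of_Kc_ne_top {D : List Bool →. List Bool} {x : List Bool}
    (h : Kc D x ≠ ⊤) : ∃ p, x ∈ D p ∧ p.length = (Kc D x).toNat := by
  have hne : {n : ℕ∞ | ∃ p : List Bool, x ∈ D p ∧ (p.length : ℕ∞) = n}.Nonempty := by
    by_contra hne
    exact h (by rw [Kc, Set.not_nonempty_iff_eq_empty.1 hne, sInf_empty])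
  obtain ⟨p, hp, hl⟩ := csInf_mem hne
  exact ⟨p, hp, by rw [Kc, ← hl, ENat.toNat_natCast]⟩

theorem OptimalDecompressor.exists_program {U : List Bool →. List Bool}
    (hU : OptimalDecompressor U) (x : List Bool) :
    ∃ p, x ∈ U p ∧ p.length = (Kc U x).toNat := by
  obtain ⟨c, hc⟩ := hU.2 _ Partrec.some
  refine exists_program_of_Kc_ne_top (ne_top_of_le_ne_top ?_ (hc x))
  exact ne_top_of_le_ne_top (ENat.natCast_ne_top (x.length + c))
    (by push_cast; gcongr; exact Kc_le_of_mem (Part.mem_some x))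

theorem OptimalCondDecompressor.exists_program {U₂ : List Bool × List Bool →. List Bool}
    (hU₂ : OptimalCondDecompressor U₂) (x y : List Bool) :
    ∃ p, x ∈ U₂ (p, y) ∧ p.length = (KcCond U₂ x y).toNat := by
  obtain ⟨c, hc⟩ := hU₂.2 (fun q => Part.some q.1) Computable.fst.partrec
  refine exists_program_of_Kc_ne_top (D := fun p => U₂ (p, y))
    (ne_top_of_le_ne_top ?_ (hc x y))
  exact ne_top_of_le_ne_top (ENat.natCast_ne_top (x.length + c))
    (by push_cast; gcongr; exact Kc_le_of_mem (D := fun p => Part.some p) (Part.mem_some x))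

theorem toNat_le_of_le_add {a b : ℕ∞} {l c : ℕ} (h : a ≤ b + c) (hb : b ≤ l) :
    a.toNat ≤ l + c :=
  ENat.toNat_le_of_le_natCast (h.trans (by push_cast; gcongr))

/-- Describing a string by a number and a binary string costs the length of the string plus twice
the logarithm of the number. -/
theorem OptimalDecompressor.exists_bound {U : List Bool →. List Bool}
    (hU : OptimalDecompressor U) {f : ℕ × List Bool →. List Bool} (hf : Partrec f) :
    ∃ c, ∀ n r x, x ∈ f (n, r) → (Kc U x).toNat ≤ r.length + 2 * Nat.log 2 n + c := by
  obtain ⟨c, hc⟩ := hU.2 _ (hf.comp computable_splitHeader)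
  refine ⟨3 + c, fun n r x hx => ?_⟩
  obtain ⟨p, hp, hl⟩ := exists_splitHeader_eq n r
  have := toNat_le_of_le_add (hc x) (Kc_le_of_mem (p := p) (by simpa only [hp] using hx))
  omega

/-- Conditional version of `OptimalDecompressor.exists_bound`. -/
theorem OptimalCondDecompressor.exists_bound {U₂ : List Bool × List Bool →. List Bool}
    (hU₂ : OptimalCondDecompressor U₂) {f : (ℕ × List Bool) × List Bool →. List Bool}
    (hf : Partrec f) :
    ∃ c, ∀ n r x y, x ∈ f ((n, r), y) →
      (KcCond U₂ x y).toNat ≤ r.length + 2 * Nat.log 2 n + c := by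
  obtain ⟨c, hc⟩ := hU₂.2 _
    (hf.comp ((computable_splitHeader.comp Computable.fst).pair Computable.snd))
  refine ⟨3 + c, fun n r x y hx => ?_⟩
  obtain ⟨p, hp, hl⟩ := exists_splitHeader_eq n r
  have := toNat_le_of_le_add (hc x y)
    (Kc_le_of_mem (D := fun p => f (splitHeader p, y)) (p := p) (by simpa only [hp] using hx))
  omega

theorem exists_KcCond_le_Kc {U : List Bool →. List Bool} (hU : OptimalDecompressor U)
    {U₂ : List Bool × List Bool →. List Bool} (hU₂ : OptimalCondDecompressor U₂) :
    ∃ c, ∀ x y, (KcCond U₂ x y).toNat ≤ (Kc U x).toNat + c := by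
  obtain ⟨c, hc⟩ := hU₂.2 _ (hU.1.comp Computable.fst)
  refine ⟨c, fun x y => ?_⟩
  obtain ⟨p, hp, hl⟩ := hU.exists_program x
  exact hl ▸ toNat_le_of_le_add (hc x y) (Kc_le_of_mem (D := U) hp)

/-- The easy direction of symmetry of information. -/
theorem exists_Kc_pair_le {U : List Bool →. List Bool} (hU : OptimalDecompressor U)
    {U₂ : List Bool × List Bool →. List Bool} (hU₂ : OptimalCondDecompressor U₂)
    {pair : List Bool × List Bool → List Bool} (hpair : Computable pair) :
    ∃ c, ∀ x y, (Kc U (pair (x, y))).toNat ≤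
      (KcCond U₂ x y).toNat + (Kc U y).toNat + 2 * Nat.log 2 (Kc U y).toNat + c := by
  have hf : Partrec fun a : ℕ × List Bool =>
      (U (a.2.take a.1)).bind fun y => (U₂ (a.2.drop a.1, y)).map fun x => pair (x, y) := by
    refine Partrec.bind
      (hU.1.comp (Primrec.list_take.to_comp.comp Computable.fst Computable.snd)) ?_
    refine Partrec.map (hU₂.1.comp (Computable.pair (Primrec.list_drop.to_comp.comp
      (Computable.fst.comp Computable.fst) (Computable.snd.comp Computable.fst))
      Computable.snd)) ?_
    exact hpair.comp (Computable.pair Computable.snd (Computable.snd.comp Computable.fst))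
  obtain ⟨c, hc⟩ := hU.exists_bound hf
  refine ⟨c, fun x y => ?_⟩
  obtain ⟨p, hp, hpl⟩ := hU.exists_program y
  obtain ⟨q, hq, hql⟩ := hU₂.exists_program x y
  have := hc p.length (p ++ q) (pair (x, y)) (by
    simp only [List.take_left, List.drop_left]
    exact Part.mem_bind hp (Part.mem_map _ hq))
  rw [List.length_append, hpl, hql] at this
  omega

theorem Partrec.exists_stage {U : List Bool →. List Bool} (hU : Partrec U) :
    ∃ T : ℕ × List Bool × List Bool → Bool, Computable T ∧
      ∀ p x, x ∈ U p ↔ ∃ t, T (t, p, x) = true := by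
  obtain ⟨c, hc⟩ := Nat.Partrec.Code.exists_code.1 hU
  refine ⟨fun a => decide (c.evaln a.1 (encode a.2.1) = some (encode a.2.2)), ?_, fun p x => ?_⟩
  · refine (Primrec.eq.decide.comp (Nat.Partrec.Code.primrec_evaln.comp
      ((Primrec.fst.pair (Primrec.const c)).pair
        (Primrec.encode.comp (Primrec.fst.comp Primrec.snd))))
      (Primrec.option_some.comp (Primrec.encode.comp (Primrec.snd.comp Primrec.snd)))).to_comp
  · have h := congrFun hc (encode p)
    simp only [encodek, Part.coe_some, Part.bind_some] at h
    have h' : x ∈ U p ↔ encode x ∈ c.eval (encode p) := by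
      simp [h]
    simp [h', Nat.Partrec.Code.evaln_complete]

theorem card_le_two_pow_of_programs {σ : Type*} {n : ℕ} {R : List Bool → σ → Prop}
    (hR : ∀ p z z', R p z → R p z' → z = z') (S : Finset σ)
    (hS : ∀ z ∈ S, ∃ p, p.length = n ∧ R p z) : S.card ≤ 2 ^ n := by
  choose! f hf using hS
  have h : (S.image f).card ≤ 2 ^ n := by
    calc (S.image f).card ≤ (Finset.univ.image fun v : List.Vector Bool n => v.toList).card := by
          refine Finset.card_le_card fun p hp => ?_
          obtain ⟨z, hz, rfl⟩ := Finset.mem_image.1 hp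
          exact Finset.mem_image.2 ⟨⟨f z, (hf z hz).1⟩, Finset.mem_univ _, rfl⟩
      _ ≤ 2 ^ n := Finset.card_image_le.trans (by simp)
  rwa [Finset.card_image_of_injOn] at h
  intro z hz z' hz' e
  exact hR (f z) z z' (hf z hz).2 (e ▸ (hf z' hz').2)

theorem card_mul_le_two_pow_of_programs {σ τ : Type*} {n N : ℕ} {R : List Bool → σ × τ → Prop}
    (hR : ∀ p z z', R p z → R p z' → z = z') (S : Finset τ)
    (hS : ∀ y ∈ S, ∃ V : Finset σ, N ≤ V.card ∧ ∀ x ∈ V, ∃ p, p.length = n ∧ R p (x, y)) :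
    S.card * N ≤ 2 ^ n := by
  choose! V hV using hS
  calc S.card * N ≤ ∑ y ∈ S, (V y).card := by
        simpa using Finset.card_nsmul_le_sum S _ N fun y hy => (hV y hy).1
    _ = (S.sigma V).card := (Finset.card_sigma _ _).symm
    _ ≤ 2 ^ n := by
      refine card_le_two_pow_of_programs (R := fun p (z : (_ : τ) × σ) => R p (z.2, z.1)) ?_ _ ?_
      · rintro p ⟨y, x⟩ ⟨y', x'⟩ h h'
        have := hR _ _ _ h h'
        simp_all
      · rintro ⟨y, x⟩ hz
        rw [Finset.mem_sigma] at hz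
        exact (hV y hz.1).2 x hz.2

theorem primrec_two_pow : Primrec fun n : ℕ => 2 ^ n := by
  refine (Primrec.nat_iterate Primrec.id (Primrec.const 1)
    (Primrec.nat_double.comp₂ Primrec₂.right)).of_eq fun n => ?_
  induction n with
  | zero => rfl
  | succ n ih => simp only [id, Function.iterate_succ_apply'] at ih ⊢; rw [ih, pow_succ']

/-- The hard direction of symmetry of information. -/
theorem exists_KcCond_add_Kc_le {U : List Bool →. List Bool} (hU : OptimalDecompressor U)
    {U₂ : List Bool × List Bool →. List Bool} (hU₂ : OptimalCondDecompressor U₂)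
    {pair : List Bool × List Bool → List Bool} (hpair : Computable pair)
    (hinj : Function.Injective pair) :
    ∃ c, ∀ x y, (KcCond U₂ x y).toNat + (Kc U y).toNat ≤
      (Kc U (pair (x, y))).toNat + 4 * Nat.log 2 (Kc U (pair (x, y))).toNat + c := by
  obtain ⟨T, hTc, hT⟩ := hU.1.exists_stage
  -- `T₁ (n, y)` semi-decides the `x` such that `pair (x, y)` has a program of length `n`
  let T₁ : ℕ × List Bool → (ℕ × List Bool) × List Bool → Bool := fun a b =>
    decide (b.1.2.length = a.1) && T (b.1.1, b.1.2, pair (b.2, a.2))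
  -- `T₂ (n, m)` semi-decides the `y` for which `T₁ (n, y)` finds at least `2 ^ m` strings
  let T₂ : ℕ × ℕ → ℕ × List Bool → Bool := fun a b =>
    decide (2 ^ a.2 ≤ (enumStage (T₁ (a.1, b.2)) b.1).length)
  have hT₁ : Computable₂ T₁ := by
    have hp : Computable fun q : (ℕ × List Bool) × (ℕ × List Bool) × List Bool => q.2.1.2 :=
      Computable.snd.comp (Computable.fst.comp Computable.snd)
    refine Primrec.and.to_comp.comp (Primrec.eq.decide.to_comp.comp
      (Computable.list_length.comp hp) (Computable.fst.comp Computable.fst)) (hTc.comp ?_)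
    exact (Computable.fst.comp (Computable.fst.comp Computable.snd)).pair (hp.pair (hpair.comp
      ((Computable.snd.comp Computable.snd).pair (Computable.snd.comp Computable.fst))))
  have hT₂ : Computable₂ T₂ := by
    refine Primrec.nat_le.decide.to_comp.comp
      (primrec_two_pow.to_comp.comp (Computable.snd.comp Computable.fst))
      (Computable.list_length.comp ((computable_enumStage hT₁).comp ?_
        (Computable.fst.comp Computable.snd)))
    exact (Computable.fst.comp Computable.fst).pair (Computable.snd.comp Computable.snd)
  have hval : Computable binVal := primrec_binVal.to_comp
  obtain ⟨c₁, hc₁⟩ := hU₂.exists_bound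
    (f := fun a => enumNth (T₁ (a.1.1, a.2)) (binVal a.1.2))
    ((partrec_enumNth hT₁).comp
      ((Computable.fst.comp Computable.fst).pair Computable.snd)
      (hval.comp (Computable.snd.comp Computable.fst)))
  obtain ⟨c₂, hc₂⟩ := hU.exists_bound
    (f := fun a => enumNth (T₂ (a.1, a.1 - a.2.length)) (binVal a.2))
    ((partrec_enumNth hT₂).comp
      (Computable.fst.pair (Primrec.nat_sub.to_comp.comp Computable.fst
        (Computable.list_length.comp Computable.snd)))
      (hval.comp Computable.snd))
  let R : List Bool → List Bool × List Bool → Prop := fun p z => pair z ∈ U p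
  have hR : ∀ p z z', R p z → R p z' → z = z' := fun p z z' h h' => hinj (Part.mem_unique h h')
  have hstage : ∀ n y t, ∀ x ∈ (enumStage (T₁ (n, y)) t).toFinset,
      ∃ p, p.length = n ∧ R p (x, y) := by
    intro n y t x hx
    obtain ⟨⟨s, p⟩, hw⟩ := exists_of_mem_enumStage (List.mem_toFinset.1 hx)
    simp only [T₁, Bool.and_eq_true, decide_eq_true_eq] at hw
    exact ⟨p, hw.1, (hT _ _).2 ⟨s, hw.2⟩⟩
  refine ⟨1 + c₁ + c₂, fun x y => ?_⟩
  obtain ⟨p, hp, hpn⟩ := hU.exists_program (pair (x, y))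
  generalize (Kc U (pair (x, y))).toNat = n at *
  obtain ⟨t, ht⟩ := (hT _ _).1 hp
  have hw : T₁ (n, y) ((t, p), x) = true := by simp [T₁, hpn, ht]
  have hex : ∃ m, ∀ s, (enumStage (T₁ (n, y)) s).length ≤ 2 ^ m := by
    refine ⟨n, fun s => ?_⟩
    rw [← List.toFinset_card_of_nodup (enumStage_nodup _ s)]
    exact card_le_two_pow_of_programs (R := fun p x => R p (x, y))
      (fun p z z' h h' => by simpa using hR p _ _ h h') _ (hstage n y s)
  obtain ⟨m, hm, k, hmk, s, hs⟩ : ∃ m, (∀ s, (enumStage (T₁ (n, y)) s).length ≤ 2 ^ m) ∧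
      ∃ k, m ≤ k + 1 ∧ ∃ s, 2 ^ k ≤ (enumStage (T₁ (n, y)) s).length := by
    classical
    refine ⟨Nat.find hex, Nat.find_spec hex, ?_⟩
    rcases h : Nat.find hex with _ | k
    · obtain ⟨s, hs⟩ := exists_mem_enumStage hw
      exact ⟨0, by omega, s, List.length_pos_of_mem hs⟩
    · have := Nat.find_min hex (m := k) (by omega)
      push Not at this
      obtain ⟨s, hs⟩ := this
      exact ⟨k, le_rfl, s, hs.le⟩
  obtain ⟨i, hi, hxi⟩ := exists_mem_enumNth hw hm
  obtain ⟨r, hr, rfl⟩ := exists_binVal_eq hi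
  have hw₂ : T₂ (n, k) (s, y) = true := by simpa [T₂] using hs
  have hcard : ∀ t, (enumStage (T₂ (n, k)) t).length * 2 ^ k ≤ 2 ^ n := by
    intro t
    rw [← List.toFinset_card_of_nodup (enumStage_nodup _ t)]
    refine card_mul_le_two_pow_of_programs hR _ fun y' hy' => ?_
    obtain ⟨u, hu⟩ := exists_of_mem_enumStage (List.mem_toFinset.1 hy')
    refine ⟨(enumStage (T₁ (n, y')) u).toFinset, ?_, hstage n y' u⟩
    rw [List.toFinset_card_of_nodup (enumStage_nodup _ u)]
    simpa [T₂] using hu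
  have hkn : k ≤ n := by
    obtain ⟨u, hu⟩ := exists_mem_enumStage hw₂
    exact (Nat.pow_le_pow_iff_right one_lt_two).1
      ((Nat.le_mul_of_pos_left _ (List.length_pos_of_mem hu)).trans (hcard u))
  have hlen : ∀ t, (enumStage (T₂ (n, k)) t).length ≤ 2 ^ (n - k) := fun t => by
    refine Nat.le_of_mul_le_mul_right ?_ (Nat.two_pow_pos k)
    rw [← pow_add, Nat.sub_add_cancel hkn]
    exact hcard t
  obtain ⟨j, hj, hyj⟩ := exists_mem_enumNth hw₂ hlen
  obtain ⟨r', hr', rfl⟩ := exists_binVal_eq hj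
  have h₁ := hc₁ n r x y hxi
  have h₂ := hc₂ n r' y (by simpa only [hr', Nat.sub_sub_self hkn] using hyj)
  omega

end Kolmogorov

/-- Symmetry of information:
`|K(x, y) − (K(x|y) + K(y))| ≤ c·(log₂(K(x)+2) + log₂(K(y)+2))`.
Complexities are everywhere finite (by optimality), and are taken as natural
numbers via `ENat.toNat`. -/
theorem symmetry_of_information
    (U : List Bool →. List Bool) (hU : OptimalDecompressor U)
    (U₂ : List Bool × List Bool →. List Bool) (hU₂ : OptimalCondDecompressor U₂)
    (pair : List Bool × List Bool → List Bool)
    (hpair : Computable pair) (hinj : Function.Injective pair) :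
    ∃ c : ℝ, ∀ x y : List Bool,
      |((Kc U (pair (x, y))).toNat : ℝ) -
          (((KcCond U₂ x y).toNat : ℝ) + ((Kc U y).toNat : ℝ))| ≤
        c * (Real.logb 2 (((Kc U x).toNat : ℝ) + 2) +
             Real.logb 2 (((Kc U y).toNat : ℝ) + 2)) := by
  obtain ⟨c₁, h₁⟩ := exists_Kc_pair_le hU hU₂ hpair
  obtain ⟨c₂, h₂⟩ := exists_KcCond_add_Kc_le hU hU₂ hpair hinj
  obtain ⟨c₃, h₃⟩ := exists_KcCond_le_Kc hU hU₂
  have hd : (0 : ℝ) ≤ Real.logb 2 (4 + c₁ + c₃) :=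
    Real.logb_nonneg one_lt_two (by linarith [c₁.cast_nonneg (α := ℝ), c₃.cast_nonneg (α := ℝ)])
  set d := Real.logb 2 (4 + c₁ + c₃)
  refine ⟨6 + c₁ + c₂ + 4 * d, fun x y => ?_⟩
  specialize h₁ x y
  specialize h₂ x y
  specialize h₃ x y
  generalize (Kc U (pair (x, y))).toNat = A at *
  generalize (KcCond U₂ x y).toNat = B at *
  generalize (Kc U x).toNat = X at *
  generalize (Kc U y).toNat = Y at *
  have one_le (N : ℕ) : (1 : ℝ) ≤ Real.logb 2 (N + 2) := by
    rw [Real.le_logb_iff_rpow_le one_lt_two (by positivity)]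
    simp
  have hX := one_le X
  have hY := one_le Y
  have hlogY : (Nat.log 2 Y : ℝ) ≤ Real.logb 2 (Y + 2) := by
    have := Real.natLog_le_logb (Y + 2) 2
    push_cast at this
    exact le_trans (by exact_mod_cast Nat.log_mono_right (by omega)) this
  have hlogA : (Nat.log 2 A : ℝ) ≤ Real.logb 2 (X + 2) + Real.logb 2 (Y + 2) + d := by
    have hA : A ≤ (X + 2) * (Y + 2) * (4 + c₁ + c₃) := by
      have : Nat.log 2 Y ≤ Y := Nat.log_le_self 2 Y
      nlinarith [Nat.zero_le (X * Y), Nat.zero_le (X * Y * (c₁ + c₃)), Nat.zero_le (X * (c₁ + c₃)),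
        Nat.zero_le (Y * (c₁ + c₃))]
    have := Real.natLog_le_logb ((X + 2) * (Y + 2) * (4 + c₁ + c₃)) 2
    push_cast at this
    rw [Real.logb_mul (by positivity) (by positivity), Real.logb_mul (by positivity) (by positivity)]
      at this
    exact le_trans (by exact_mod_cast Nat.log_mono_right hA) this
  have h₁' : (A : ℝ) ≤ B + Y + 2 * Nat.log 2 Y + c₁ := by exact_mod_cast h₁
  have h₂' : (B : ℝ) + Y ≤ A + 4 * Nat.log 2 A + c₂ := by exact_mod_cast h₂
  generalize Real.logb 2 ((X : ℝ) + 2) = u at *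
  generalize Real.logb 2 ((Y : ℝ) + 2) = v at *
  have hc₁ : (c₁ : ℝ) ≤ c₁ * (u + v) := le_mul_of_one_le_right (by positivity) (by linarith)
  have hc₂ : (c₂ : ℝ) ≤ c₂ * (u + v) := le_mul_of_one_le_right (by positivity) (by linarith)
  have hd' : d ≤ d * (u + v) := le_mul_of_one_le_right hd (by linarith)
  have hc₁_nonneg : (0 : ℝ) ≤ c₁ := by positivity
  have hc₂_nonneg : (0 : ℝ) ≤ c₂ := by positivity
  rw [abs_le]
  constructor <;> linarith
end

section
/- Complexity criterion for computability: an infinite binary sequence χ : ℕ → Bool is computable if and only if there exists a constant c such that K(χ↾n | bin(n)) ≤ c for all n, where χ↾n denotes the binary string of the first n bits of χ and bin(n) is the binary representation of n as a binary string. -/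
open Nat.Partrec in
theorem Partrec.exists_computable_stages {α σ : Type*} [Primcodable α] [Primcodable σ]
    {f : α →. σ} (hf : Partrec f) :
    ∃ g : α → ℕ → Option σ, Computable₂ g ∧
      (∀ a s t x, s ≤ t → g a s = some x → g a t = some x) ∧
      ∀ a x, x ∈ f a ↔ ∃ s, g a s = some x := by
  obtain ⟨c, hc⟩ := Code.exists_code.1 hf
  refine ⟨fun a s => (Code.evaln s c (Encodable.encode a)).bind Encodable.decode, ?_, ?_, ?_⟩
  · refine Primrec.to_comp (Primrec.option_bind ?_ (Primrec.decode.comp Primrec.snd).to₂)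
    exact Code.primrec_evaln.comp
      ((Primrec.snd.pair (Primrec.const c)).pair (Primrec.encode.comp Primrec.fst))
  · intro a s t x hst h
    obtain ⟨y, hy, hx⟩ := Option.bind_eq_some_iff.1 h
    exact Option.bind_eq_some_iff.2 ⟨y, Code.evaln_mono hst hy, hx⟩
  · intro a x
    have heval (y : ℕ) : y ∈ Code.eval c (Encodable.encode a) ↔
        ∃ z ∈ f a, Encodable.encode z = y := by
      simp [hc]
    constructor
    · intro hx
      obtain ⟨s, hs⟩ := Code.evaln_complete.1 ((heval _).2 ⟨x, hx, rfl⟩)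
      exact ⟨s, Option.bind_eq_some_iff.2 ⟨_, hs, Encodable.encodek x⟩⟩
    · rintro ⟨s, hs⟩
      obtain ⟨y, hy, hx⟩ := Option.bind_eq_some_iff.1 hs
      obtain ⟨z, hz, rfl⟩ := (heval y).1 (Code.evaln_sound hy)
      rw [Encodable.encodek, Option.some_inj] at hx
      exact hx ▸ hz

theorem Primrec.nat_bits : Primrec Nat.bits := by
  have key : Primrec₂ fun (_ : Unit) (n : ℕ) => Nat.bits n := by
    refine Primrec.nat_strong_rec _
      (g := fun _ l => if l.length = 0 then some [] else
        (l[l.length.div2]?).map (fun t => l.length.bodd :: t)) ?_ ?_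
    · have hlen : Primrec fun a : Unit × List (List Bool) => a.2.length :=
        Primrec.list_length.comp Primrec.snd
      refine Primrec.ite (Primrec.eq.comp hlen (Primrec.const 0)) (Primrec.const _) ?_
      refine Primrec.option_map
        (Primrec.list_getElem?.comp Primrec.snd (Primrec.nat_div2.comp hlen)) ?_
      exact Primrec.list_cons.comp (Primrec.nat_bodd.comp (hlen.comp Primrec.fst)) Primrec.snd
    · intro _ n
      rcases Nat.eq_zero_or_pos n with rfl | hn
      · simp
      · have hlt : n.div2 < n := by rw [Nat.div2_val]; omega
        have hbits : n.bits = n.bodd :: n.div2.bits := by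
          conv_lhs => rw [← Nat.bit_bodd_div2 n]
          refine Nat.bits_append_bit _ _ fun h => ?_
          have := Nat.bit_bodd_div2 n
          rw [h] at this
          cases hb : n.bodd <;> simp_all
        simp [hn.ne', hlt, hbits]
  exact key.comp (Primrec.const ()) Primrec.id

theorem Primrec.foldr_bit : Primrec fun l : List Bool => l.foldr Nat.bit 0 := by
  have hbit : Primrec₂ Nat.bit :=
    (Primrec.cond Primrec.fst (Primrec.nat_double_succ.comp Primrec.snd)
      (Primrec.nat_double.comp Primrec.snd)).of_eq fun ⟨b, n⟩ => by cases b <;> rfl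
  exact Primrec.list_foldr Primrec.id (Primrec.const 0) (hbit.comp₂
    (Primrec.fst.comp Primrec.snd).to₂ (Primrec.snd.comp Primrec.snd).to₂)

theorem Nat.foldr_bit_bits (n : ℕ) : n.bits.foldr Nat.bit 0 = n := by
  induction n using Nat.binaryRec' with
  | zero => simp
  | bit b n hn ih => rw [Nat.bits_append_bit _ _ hn]; simp [ih]

theorem Computable.map_range {σ : Type*} [Primcodable σ] {f : ℕ → σ} (hf : Computable f) :
    Computable fun n => (List.range n).map f := by
  refine (Computable.nat_rec (h := fun _ q => q.2 ++ [f q.1]) Computable.id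
    (Computable.const ([] : List σ)) ?_).of_eq fun n => ?_
  · exact Computable.list_concat.comp (Computable.snd.comp Computable.snd)
      (hf.comp (Computable.fst.comp Computable.snd))
  · induction n with
    | zero => rfl
    | succ n ih => simp_all [List.range_succ]

theorem Computable.card_filter {α β : Type*} [Primcodable α] {h : α → β → Bool}
    (hh : ∀ b, Computable fun a => h a b) (Q : Finset β) :
    Computable fun a => (Q.filter fun b => h a b = true).card := by
  classical
  induction Q using Finset.induction_on with
  | empty => simpa using Computable.const 0
  | insert b Q hb ih =>
    refine (Computable.cond (hh b) (Computable.succ.comp ih) ih).of_eq fun a => ?_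
    rw [Finset.filter_insert]
    cases h a b <;> simp [hb]

theorem KcCond_le_coe_iff (D : List Bool × List Bool →. List Bool) (x y : List Bool) (c : ℕ) :
    KcCond D x y ≤ (c : ℕ∞) ↔ ∃ p : List Bool, p.length ≤ c ∧ x ∈ D (p, y) := by
  constructor
  · intro h
    have hne : {n : ℕ∞ | ∃ p : List Bool, x ∈ D (p, y) ∧ (p.length : ℕ∞) = n}.Nonempty := by
      by_contra hne
      rw [KcCond, Set.not_nonempty_iff_eq_empty.1 hne, sInf_empty] at h
      simp at h
    obtain ⟨p, hp, hlen⟩ := csInf_mem hne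
    exact ⟨p, by exact_mod_cast hlen.trans_le h, hp⟩
  · rintro ⟨p, hlen, hp⟩
    exact le_trans (sInf_le ⟨p, hp, rfl⟩) (Nat.cast_le.2 hlen)

/-- Among the rows of a doubly indexed sequence with an eventually bounded row, some row has the
least upper limit. -/
theorem exists_minimal_eventual_bound (w : ℕ → ℕ → ℕ) (N : ℕ) (hw : ∀ n, w 0 n ≤ N) :
    ∃ m k n₀, (∀ n ≥ n₀, w m n ≤ k) ∧ ∀ m' n₁, ∃ n ≥ n₁, k ≤ w m' n := by
  classical
  have hex : ∃ k m n₀, ∀ n ≥ n₀, w m n ≤ k := ⟨N, 0, 0, fun n _ => hw n⟩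
  obtain ⟨m, n₀, h⟩ := Nat.find_spec hex
  refine ⟨m, _, n₀, h, fun m' n₁ => ?_⟩
  by_contra! hlt
  have hpos := hlt n₁ le_rfl
  exact Nat.find_min hex (m := Nat.find hex - 1) (by omega)
    ⟨m', n₁, fun n hn => by have := hlt n hn; omega⟩

/-- A binary sequence is computable if for each of its values one can computably search for a
certificate of that value. -/
theorem Computable.of_certificates {α : Type*} [Primcodable α] {χ : α → Bool}
    {ok : Bool → α → ℕ → Bool} (hokc : ∀ b, Computable₂ (ok b))
    (hsound : ∀ b a t, ok b a t = true → χ a = b) (hcomplete : ∀ a, ∃ t, ok (χ a) a t = true) :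
    Computable χ := by
  let F : α → ℕ → Option Bool := fun a t =>
    bif ok true a t then some true else bif ok false a t then some false else none
  have hF : Computable₂ F := Computable.cond (hokc true) (Computable.const _)
    (Computable.cond (hokc false) (Computable.const _) (Computable.const _))
  have hF_sound (a : α) (t : ℕ) (b : Bool) (h : F a t = some b) : χ a = b := by
    refine hsound b a t ?_
    cases ht : ok true a t <;> cases hf : ok false a t <;> cases b <;> simp_all [F]
  refine (Partrec.rfindOpt hF).of_eq_tot fun a => ?_
  have hdom : (Nat.rfindOpt (F a)).Dom := by
    obtain ⟨t, h⟩ := hcomplete a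
    refine Nat.rfindOpt_dom.2 ⟨t, ?_⟩
    cases ht : ok true a t
    · cases hb : χ a
      · rw [hb] at h
        exact ⟨false, by simp [F, ht, h]⟩
      · rw [hb, ht] at h
        cases h
    · exact ⟨true, by simp [F, ht]⟩
  obtain ⟨t, ht⟩ := Nat.rfindOpt_spec (Part.get_mem hdom)
  rw [hF_sound a t _ ht]
  exact Part.get_mem hdom

/-- A sequence whose initial segments `χ↾n` are each produced, given `n`, by one of finitely many
programs is computable. -/
theorem computable_of_finite_programs {β : Type*} (f : β → ℕ →. List Bool)
    (hf : ∀ p, Partrec (f p)) (Q : Finset β) (χ : ℕ → Bool)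
    (hχ : ∀ n, ∃ p ∈ Q, (List.range n).map χ ∈ f p n) : Computable χ := by
  classical
  choose g hg hmono hmem using fun p => (hf p).exists_computable_stages
  let Agrees : ℕ → List Bool → Prop := fun m x => ∀ j < m, x[j]? = some (χ j)
  have hagrees (m : ℕ) : PrimrecPred (Agrees m) := by
    refine (Primrec.eq.comp (Primrec.list_map (Primrec.const (List.range m))
      Primrec.list_getElem?) (Primrec.const ((List.range m).map fun j => some (χ j)))).of_eq
      fun x => ?_
    simp [Agrees, List.map_inj_left]
  -- `W m n` is the set of programs whose output on `n` agrees with `χ` on the first `m` bits.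
  let W : ℕ → ℕ → Finset β := fun m n => Q.filter fun p => ∃ x ∈ f p n, Agrees m x
  obtain ⟨m, k, n₀, hle, hge⟩ := exists_minimal_eventual_bound (fun m n => (W m n).card) Q.card
    fun n => Finset.card_filter_le _ _
  obtain ⟨V, hV, hVc⟩ : ∃ V : Bool → ((ℕ × ℕ) × ℕ) → Finset β,
      (∀ b i n s p, p ∈ V b ((i, n), s) ↔
        p ∈ Q ∧ ∃ x, g p n s = some x ∧ Agrees m x ∧ x[i]? = some b) ∧
      ∀ b, Computable fun a => (V b a).card := by
    let test : Bool → ((ℕ × ℕ) × ℕ) → β → Bool := fun b a p =>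
      (g p a.1.2 a.2).elim false fun x => decide (Agrees m x) && decide (x[a.1.1]? = some b)
    have htest (b : Bool) (p : β) : Computable fun a => test b a p := by
      refine (Computable.option_casesOn
        ((hg p).comp (Computable.snd.comp Computable.fst) Computable.snd)
        (Computable.const false) ?_).of_eq fun a =>
          show _ = (g p a.1.2 a.2).elim false _ by cases g p a.1.2 a.2 <;> rfl
      have hbit : Primrec fun q : ((ℕ × ℕ) × ℕ) × List Bool => decide (q.2[q.1.1.1]? = some b) :=
        PrimrecPred.decide <| Primrec.eq.comp (Primrec.list_getElem?.comp Primrec.snd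
          (Primrec.fst.comp (Primrec.fst.comp Primrec.fst))) (Primrec.const (some b))
      exact (Primrec.and.comp ((hagrees m).decide.comp Primrec.snd) hbit).to_comp
    let V : Bool → ((ℕ × ℕ) × ℕ) → Finset β := fun b a => Q.filter fun p => test b a p = true
    refine ⟨V, fun b i n s p => ?_, fun b => Computable.card_filter (htest b) Q⟩
    rw [Finset.mem_filter]
    simp only [test]
    cases g p n s <;> simp
  have hsound (b : Bool) (i n s : ℕ) (hn₀ : n₀ ≤ n) (hm : m ≤ n) (hi : i < n)
      (hk : k ≤ (V b ((i, n), s)).card) : χ i = b := by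
    have hsub : V b ((i, n), s) ⊆ W m n := by
      intro p hp
      obtain ⟨hpQ, x, hx, hxm, -⟩ := (hV ..).1 hp
      exact Finset.mem_filter.2 ⟨hpQ, x, (hmem ..).2 ⟨s, hx⟩, hxm⟩
    have heq := Finset.eq_of_subset_of_card_le hsub ((hle n hn₀).trans hk)
    obtain ⟨p, hpQ, hp⟩ := hχ n
    have hpW : p ∈ W m n :=
      Finset.mem_filter.2 ⟨hpQ, _, hp, fun j hj => by simp [hj.trans_le hm]⟩
    rw [← heq] at hpW
    obtain ⟨-, x, hx, -, hxb⟩ := (hV ..).1 hpW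
    obtain rfl := Part.mem_unique ((hmem ..).2 ⟨s, hx⟩) hp
    simpa [hi] using hxb
  have hcomplete (i : ℕ) :
      ∃ n s, n₀ ≤ n ∧ m ≤ n ∧ i < n ∧ k ≤ (V (χ i) ((i, n), s)).card := by
    obtain ⟨n, hn, hk⟩ := hge (max m (i + 1)) (max n₀ (max m (i + 1)))
    have hW (p : β) : ∃ s, p ∈ W (max m (i + 1)) n → p ∈ V (χ i) ((i, n), s) := by
      by_cases hp : p ∈ W (max m (i + 1)) n
      · obtain ⟨hpQ, x, hx, hxm⟩ := Finset.mem_filter.1 hp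
        obtain ⟨s, hs⟩ := (hmem ..).1 hx
        exact ⟨s, fun _ => (hV ..).2 ⟨hpQ, x, hs, fun j hj => hxm j (by omega),
          hxm i (by omega)⟩⟩
      · exact ⟨0, fun h => absurd h hp⟩
    choose s hs using hW
    refine ⟨n, Q.sup s, by omega, by omega, by omega, hk.trans (Finset.card_le_card ?_)⟩
    intro p hp
    obtain ⟨hpQ, x, hx, hx'⟩ := (hV ..).1 (hs p hp)
    exact (hV ..).2 ⟨hpQ, x, hmono _ _ _ _ _ (Finset.le_sup hpQ) hx, hx'⟩
  refine Computable.of_certificates (ok := fun b i t =>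
    decide (n₀ ≤ t.unpair.1) && (decide (m ≤ t.unpair.1) && (decide (i < t.unpair.1) &&
      decide (k ≤ (V b ((i, t.unpair.1), t.unpair.2)).card)))) (fun b => ?_) ?_ ?_
  · have hunpair : Primrec fun a : ℕ × ℕ => a.2.unpair := Primrec.unpair.comp Primrec.snd
    have hfst : Primrec fun a : ℕ × ℕ => a.2.unpair.1 := Primrec.fst.comp hunpair
    have hcard : Computable fun a : ℕ × ℕ => (V b ((a.1, a.2.unpair.1), a.2.unpair.2)).card :=
      (hVc b).comp ((Primrec.fst.pair hfst).pair (Primrec.snd.comp hunpair)).to_comp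
    have hk : Computable fun n : ℕ => decide (k ≤ n) :=
      (Primrec.nat_le.comp (Primrec.const k) Primrec.id).decide.to_comp
    have hand {p q : ℕ × ℕ → Bool} (hp : Computable p) (hq : Computable q) :
        Computable fun a => p a && q a := Primrec.and.to_comp.comp hp hq
    exact hand (Primrec.nat_le.comp (Primrec.const n₀) hfst).decide.to_comp
      (hand (Primrec.nat_le.comp (Primrec.const m) hfst).decide.to_comp
        (hand (Primrec.nat_lt.comp Primrec.fst hfst).decide.to_comp (hk.comp hcard)))
  · intro b i t h
    simp only [Bool.and_eq_true, decide_eq_true_eq] at h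
    exact hsound b i _ _ h.1 h.2.1 h.2.2.1 h.2.2.2
  · intro i
    obtain ⟨n, s, h⟩ := hcomplete i
    exact ⟨Nat.pair n s, by simpa using h⟩

/-- An infinite binary sequence `χ` is computable iff the conditional
complexities `K(χ↾n | bin(n))` are bounded by a constant. Here `χ↾n` is the
string of the first `n` bits of `χ` and `bin(n) = n.bits` is the binary
representation of `n`. -/
theorem computable_iff_conditional_complexity_bounded
    (U₂ : List Bool × List Bool →. List Bool) (hU₂ : OptimalCondDecompressor U₂)
    (χ : ℕ → Bool) :
    Computable χ ↔
      ∃ c : ℕ, ∀ n : ℕ,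
        KcCond U₂ ((List.range n).map χ) (Nat.bits n) ≤ (c : ℕ∞) := by
  constructor
  · intro hχ
    let D : List Bool × List Bool → List Bool := fun q =>
      (List.range (q.2.foldr Nat.bit 0)).map χ
    have hD : Computable D :=
      hχ.map_range.comp (Primrec.foldr_bit.comp Primrec.snd).to_comp
    obtain ⟨c, hc⟩ := hU₂.2 (D : List Bool × List Bool →. List Bool) hD
    refine ⟨c, fun n => (hc _ _).trans ?_⟩
    have hzero : KcCond (D : List Bool × List Bool →. List Bool)
        ((List.range n).map χ) (Nat.bits n) ≤ ((0 : ℕ) : ℕ∞) :=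
      (KcCond_le_coe_iff ..).2 ⟨[], le_rfl, by simp [D, Nat.foldr_bit_bits]⟩
    calc _ ≤ ((0 : ℕ) : ℕ∞) + (c : ℕ∞) := by gcongr
      _ = c := by simp
  · rintro ⟨c, hc⟩
    refine computable_of_finite_programs (fun p n => U₂ (p, Nat.bits n)) (fun p => ?_)
      (List.finite_length_le Bool c).toFinset χ fun n => ?_
    · exact hU₂.1.comp ((Primrec.const p).pair Primrec.nat_bits).to_comp
    · obtain ⟨p, hlen, hp⟩ := (KcCond_le_coe_iff ..).1 (hc n)
      exact ⟨p, by simpa using hlen, hp⟩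
end

section
/- There exists a maximal effectively null set: an effectively null set N ⊆ Ω such that every effectively null set X ⊆ Ω satisfies X ⊆ N. -/
open scoped ENNReal

/-- The interval `Ω_u`: the set of infinite binary sequences extending the
binary string `u`. -/
def Cyl (u : List Bool) : Set (ℕ → Bool) :=
  {ω | ∀ i : Fin u.length, ω i = u.get i}

/-- A set `X` of infinite binary sequences is effectively null if a computable
function produces, for every positive rational `ε` (and index `i`), strings
`u_i(ε)` such that the intervals `Ω_{u_i(ε)}` cover `X` and
`∑_i 2^{−|u_i(ε)|} ≤ ε`. -/
def EffNull (X : Set (ℕ → Bool)) : Prop :=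
  ∃ u : ℚ × ℕ → List Bool, Computable u ∧
    ∀ ε : ℚ, 0 < ε →
      (X ⊆ ⋃ i : ℕ, Cyl (u (ε, i))) ∧
      (∑' i : ℕ, (2 : ℝ≥0∞) ^ (-((u (ε, i)).length : ℤ)) ≤
        ENNReal.ofReal (ε : ℝ))

theorem Primrec.nat_pow : Primrec₂ ((· ^ ·) : ℕ → ℕ → ℕ) :=
  Primrec₂.unpaired'.1 Nat.Primrec.pow

theorem PrimrecRel.nat_dvd : PrimrecRel ((· ∣ ·) : ℕ → ℕ → Prop) :=
  PrimrecPred.of_eq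
    (Primrec.eq.comp (Primrec.nat_mod.comp Primrec.snd Primrec.fst) (Primrec.const 0))
    fun _ => (Nat.dvd_iff_mod_eq_zero).symm

theorem PrimrecRel.nat_coprime : PrimrecRel Nat.Coprime := by
  have hR : PrimrecRel fun (d : ℕ) (p : ℕ × ℕ) => d ∣ p.1 → d ∣ p.2 → d = 1 :=
    PrimrecPred.of_eq
      ((PrimrecRel.nat_dvd.comp Primrec.fst (Primrec.fst.comp Primrec.snd)).not.or
        ((PrimrecRel.nat_dvd.comp Primrec.fst (Primrec.snd.comp Primrec.snd)).not.or
          (Primrec.eq.comp Primrec.fst (Primrec.const 1))))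
      fun _ => by tauto
  refine PrimrecPred.of_eq
    (hR.forall_mem_list.comp
      (Primrec.list_range.comp
        (Primrec.nat_add.comp (Primrec.nat_add.comp Primrec.fst Primrec.snd) (Primrec.const 2)))
      (Primrec.pair Primrec.fst Primrec.snd)) fun p => ?_
  obtain ⟨a, b⟩ := p
  simp only [List.mem_range]
  constructor
  · intro h
    by_contra hab
    rcases Nat.eq_zero_or_pos (a + b) with h0 | h0
    · obtain ⟨rfl, rfl⟩ : a = 0 ∧ b = 0 := by omega
      have := h 0 (by omega) (dvd_refl _) (dvd_refl _)
      omega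
    · have hle : Nat.gcd a b ≤ a + b := by
        rcases Nat.eq_zero_or_pos a with ha | ha
        · have := Nat.gcd_le_right a (n := b) (by omega)
          omega
        · have := Nat.gcd_le_left b ha
          omega
      exact hab (h _ (by omega) (Nat.gcd_dvd_left a b) (Nat.gcd_dvd_right a b))
  · intro h d _ h1 h2
    exact Nat.eq_one_of_dvd_coprimes h h1 h2

namespace Rat

open Encodable

/-- The code of a rational as a pair of codes of its numerator and its denominator. -/
def pairCode (q : ℚ) : ℕ := Nat.pair (encode q.num) q.den

/-- The code of a rational in the `Primcodable` structure on `ℚ`: the rank of its `pairCode` among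
the values of `pairCode`. -/
def rank (q : ℚ) : ℕ := @encode ℚ Primcodable.toEncodable q

open Classical in
theorem rank_eq_count (q : ℚ) : rank q = Nat.count (· ∈ Set.range pairCode) (pairCode q) := by
  have hcongr : ∀ (p : ℕ → Prop) (i j : DecidablePred p) (n : ℕ),
      @Nat.count p i n = @Nat.count p j n := by
    intro p i j n
    congr!
  exact hcongr _ (@decidableRangeEncode ℚ instEncodable) _ _

theorem rank_lt_rank {q r : ℚ} (h : pairCode q < pairCode r) : rank q < rank r := by
  classical
  rw [rank_eq_count, rank_eq_count]
  exact Nat.count_strict_mono ⟨q, rfl⟩ h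

theorem rank_le_rank {q r : ℚ} (h : pairCode q ≤ pairCode r) : rank q ≤ rank r := by
  classical
  rw [rank_eq_count, rank_eq_count]
  exact Nat.count_monotone _ h

theorem encode_int_natCast (n : ℕ) : encode (n : ℤ) = 2 * n := rfl

theorem pairCode_inv_natCast (n : ℕ) : pairCode ((n + 1 : ℕ) : ℚ)⁻¹ = Nat.pair 2 (n + 1) := by
  unfold pairCode
  rw [Rat.inv_natCast_num_of_pos n.succ_pos, Rat.inv_natCast_den_of_pos n.succ_pos]
  rfl

theorem pairCode_inv_den_le {q : ℚ} (hq : 0 < q) : pairCode (q.den : ℚ)⁻¹ ≤ pairCode q := by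
  obtain ⟨n, hn⟩ := Nat.exists_eq_succ_of_ne_zero q.den_nz
  have hnum : (q.num.toNat : ℤ) = q.num := Int.toNat_of_nonneg (Rat.num_pos.2 hq).le
  have hpos := Rat.num_pos.2 hq
  rw [hn, Nat.succ_eq_add_one, pairCode_inv_natCast, pairCode, ← hnum, encode_int_natCast, hn]
  rcases (show 2 ≤ 2 * q.num.toNat by omega).eq_or_lt with h | h
  · rw [← h]
  · exact (Nat.pair_lt_pair_left _ h).le

theorem den_le_rank_add_one {q : ℚ} (hq : 0 < q) : q.den ≤ rank q + 1 := by
  have hmono : StrictMono fun n : ℕ => rank ((n + 1 : ℕ) : ℚ)⁻¹ := by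
    refine strictMono_nat_of_lt_succ fun n => rank_lt_rank ?_
    rw [pairCode_inv_natCast, pairCode_inv_natCast]
    exact Nat.pair_lt_pair_right _ (Nat.lt_succ_self _)
  obtain ⟨n, hn⟩ := Nat.exists_eq_succ_of_ne_zero q.den_nz
  have h1 := hmono.le_apply (x := n)
  have h2 : rank (q.den : ℚ)⁻¹ ≤ rank q := rank_le_rank (pairCode_inv_den_le hq)
  rw [hn, Nat.succ_eq_add_one] at h2 ⊢
  exact Nat.succ_le_succ (h1.trans h2)

theorem inv_two_pow_rank_le {q : ℚ} (hq : 0 < q) : ((2 : ℚ) ^ rank q)⁻¹ ≤ q := by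
  have h1 : (q.den : ℚ)⁻¹ ≤ q := by
    have h : (1 : ℚ) ≤ q.num := by exact_mod_cast Rat.num_pos.2 hq
    calc (q.den : ℚ)⁻¹ = 1 / q.den := (one_div _).symm
      _ ≤ q.num / q.den := by gcongr
      _ = q := Rat.num_div_den q
  have h2 : (q.den : ℚ) ≤ (2 : ℚ) ^ rank q := by
    exact_mod_cast (den_le_rank_add_one hq).trans Nat.lt_two_pow_self
  exact (inv_anti₀ (by exact_mod_cast q.den_pos) h2).trans h1

theorem mem_range_pairCode_iff (n : ℕ) :
    n ∈ Set.range pairCode ↔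
      0 < n.unpair.2 ∧ Nat.Coprime ((n.unpair.1 + 1) / 2) n.unpair.2 := by
  have habs : ∀ z : ℤ, (encode z + 1) / 2 = z.natAbs := by
    rintro (m | m)
    · change (2 * m + 1) / 2 = m
      omega
    · change (2 * m + 1 + 1) / 2 = m + 1
      omega
  constructor
  · rintro ⟨q, rfl⟩
    simp only [pairCode, Nat.unpair_pair, habs]
    exact ⟨q.den_pos, q.reduced⟩
  · rintro ⟨hpos, hcop⟩
    obtain ⟨z, hz⟩ : ∃ z : ℤ, encode z = n.unpair.1 :=
      ⟨Denumerable.ofNat ℤ _, Denumerable.encode_ofNat (α := ℤ) _⟩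
    rw [← hz, habs] at hcop
    refine ⟨⟨z, n.unpair.2, hpos.ne', hcop⟩, ?_⟩
    rw [pairCode, hz, Nat.pair_unpair]

theorem primrecPred_mem_range_pairCode : PrimrecPred fun n => n ∈ Set.range pairCode := by
  have h1 : Primrec fun n : ℕ => n.unpair.1 := Primrec.fst.comp Primrec.unpair
  have h2 : Primrec fun n : ℕ => n.unpair.2 := Primrec.snd.comp Primrec.unpair
  exact PrimrecPred.of_eq
    ((Primrec.nat_lt.comp (Primrec.const 0) h2).and
      (PrimrecRel.nat_coprime.comp
        (Primrec.nat_div.comp (Primrec.succ.comp h1) (Primrec.const 2)) h2))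
    fun n => (mem_range_pairCode_iff n).symm

theorem primrec_inv_two_pow : Primrec fun k : ℕ => ((2 ^ k : ℕ) : ℚ)⁻¹ := by
  classical
  refine Primrec.encode_iff.1 ?_
  have hcode : Primrec fun k : ℕ => Nat.pair 2 (2 ^ k) :=
    Primrec₂.natPair.comp (Primrec.const 2) (Primrec.nat_pow.comp (Primrec.const 2) Primrec.id)
  refine (Primrec.list_length.comp
    ((Primrec.listFilter primrecPred_mem_range_pairCode).comp
      (Primrec.list_range.comp hcode))).of_eq fun k => ?_
  obtain ⟨n, hn⟩ := Nat.exists_eq_succ_of_ne_zero (Nat.two_pow_pos k).ne'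
  change _ = rank _
  rw [rank_eq_count, Nat.count, List.countP_eq_length_filter, hn, Nat.succ_eq_add_one,
    pairCode_inv_natCast]

end Rat

/-- The measure of the interval named by a string, and `0` if no string is given. -/
noncomputable def optCylMeasure (o : Option (List Bool)) : ℝ≥0∞ :=
  o.elim 0 fun x => (2 ^ x.length)⁻¹

theorem optCylMeasure_getD_le (o : Option (List Bool)) (x : List Bool) :
    optCylMeasure (some (o.getD x)) ≤ optCylMeasure o + optCylMeasure (some x) := by
  cases o <;> simp [optCylMeasure]

theorem ENNReal.tsum_inv_two_pow_add (c : ℕ) :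
    ∑' t : ℕ, ((2 : ℝ≥0∞) ^ (c + t + 1))⁻¹ = (2 ^ c)⁻¹ := by
  have h : ∀ t : ℕ, ((2 : ℝ≥0∞) ^ (c + t + 1))⁻¹ = (2 ^ c)⁻¹ * 2⁻¹ ^ (t + 1) := fun t => by
    rw [add_assoc, ENNReal.inv_pow, pow_add, ENNReal.inv_pow]
  simp_rw [h, ENNReal.tsum_mul_left, ENNReal.tsum_geometric_add_one, ENNReal.one_sub_inv_two,
    inv_inv, ENNReal.inv_mul_cancel two_ne_zero ENNReal.ofNat_ne_top, mul_one]

/-- The sum of the measures of the first `n` given strings, as a numerator together with the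
exponent of a denominator that is a power of two. -/
def partialMeasure (w : ℕ → Option (List Bool)) (n : ℕ) : ℕ × ℕ :=
  n.rec (0, 0) fun m p =>
    (w m).casesOn p fun x => (p.1 * 2 ^ x.length + 2 ^ p.2, p.2 + x.length)

theorem sum_optCylMeasure_eq (w : ℕ → Option (List Bool)) (n : ℕ) :
    ∑ m ∈ Finset.range n, optCylMeasure (w m) =
      (partialMeasure w n).1 / 2 ^ (partialMeasure w n).2 := by
  induction n with
  | zero => simp [partialMeasure]
  | succ n ih =>
    rw [Finset.sum_range_succ, ih]
    have hs : partialMeasure w (n + 1) = (w n).casesOn (partialMeasure w n) fun x =>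
      ((partialMeasure w n).1 * 2 ^ x.length + 2 ^ (partialMeasure w n).2,
        (partialMeasure w n).2 + x.length) := rfl
    rw [hs]
    generalize partialMeasure w n = p
    cases w n with
    | none => simp [optCylMeasure]
    | some x =>
      have h0 : ∀ m : ℕ, (2 : ℝ≥0∞) ^ m ≠ 0 := fun m => by positivity
      have ht : ∀ m : ℕ, (2 : ℝ≥0∞) ^ m ≠ ⊤ := fun m => ENNReal.pow_ne_top ENNReal.ofNat_ne_top
      simp only [optCylMeasure, Option.elim_some]
      push_cast
      rw [pow_add, ENNReal.add_div, ENNReal.mul_div_mul_right _ _ (h0 _) (ht _)]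
      congr 1
      rw [← one_div, ← ENNReal.mul_div_mul_left 1 _ (h0 p.2) (ht p.2), mul_one]

theorem sum_optCylMeasure_le_iff (w : ℕ → Option (List Bool)) (k n : ℕ) :
    ∑ m ∈ Finset.range n, optCylMeasure (w m) ≤ (2 ^ k)⁻¹ ↔
      (partialMeasure w n).1 * 2 ^ k ≤ 2 ^ (partialMeasure w n).2 := by
  have h0 : ∀ m : ℕ, (2 : ℝ≥0∞) ^ m ≠ 0 := fun m => by positivity
  have ht : ∀ m : ℕ, (2 : ℝ≥0∞) ^ m ≠ ⊤ := fun m => ENNReal.pow_ne_top ENNReal.ofNat_ne_top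
  rw [sum_optCylMeasure_eq, ENNReal.div_le_iff (h0 _) (ht _), mul_comm (_⁻¹), ← div_eq_mul_inv,
    ENNReal.le_div_iff_mul_le (.inl (h0 _)) (.inl (ht _))]
  norm_cast

/-- The subsequence of a sequence of strings consisting of the strings up to which the total
measure is at most `2 ^ (-k)`. -/
def truncate (w : ℕ → Option (List Bool)) (k n : ℕ) : Option (List Bool) :=
  if (partialMeasure w (n + 1)).1 * 2 ^ k ≤ 2 ^ (partialMeasure w (n + 1)).2 then w n else none

theorem tsum_truncate_le (w : ℕ → Option (List Bool)) (k : ℕ) :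
    ∑' n, optCylMeasure (truncate w k n) ≤ (2 ^ k)⁻¹ := by
  refine ENNReal.tsum_le_of_sum_range_le fun n => ?_
  induction n with
  | zero => simp
  | succ n ih =>
    by_cases h : ∑ m ∈ Finset.range (n + 1), optCylMeasure (w m) ≤ (2 ^ k)⁻¹
    · refine (Finset.sum_le_sum fun m _ => ?_).trans h
      unfold truncate
      split_ifs
      · exact le_rfl
      · exact zero_le
    · rw [Finset.sum_range_succ, truncate, if_neg (mt (sum_optCylMeasure_le_iff w k _).2 h)]
      simpa [optCylMeasure] using ih

theorem truncate_eq_self {w : ℕ → Option (List Bool)} {k : ℕ}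
    (h : ∑' n, optCylMeasure (w n) ≤ (2 ^ k)⁻¹) (n : ℕ) : truncate w k n = w n :=
  if_pos ((sum_optCylMeasure_le_iff w k _).1 ((ENNReal.sum_le_tsum _).trans h))

theorem Computable.truncate {α : Type*} [Primcodable α] {w : α → ℕ → Option (List Bool)}
    {k n : α → ℕ} (hw : Computable₂ w) (hk : Computable k) (hn : Computable n) :
    Computable fun a => truncate (w a) (k a) (n a) := by
  have hpow : Primrec fun n : ℕ => 2 ^ n := Primrec.nat_pow.comp (Primrec.const 2) Primrec.id
  have hstep : Primrec₂ fun (p : ℕ × ℕ) (x : List Bool) =>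
      (p.1 * 2 ^ x.length + 2 ^ p.2, p.2 + x.length) := by
    have h1 : Primrec fun a : (ℕ × ℕ) × List Bool => a.1.1 := Primrec.fst.comp Primrec.fst
    have h2 : Primrec fun a : (ℕ × ℕ) × List Bool => a.1.2 := Primrec.snd.comp Primrec.fst
    have h3 : Primrec fun a : (ℕ × ℕ) × List Bool => a.2.length :=
      Primrec.list_length.comp Primrec.snd
    exact Primrec.pair
      (Primrec.nat_add.comp (Primrec.nat_mul.comp h1 (hpow.comp h3)) (hpow.comp h2))
      (Primrec.nat_add.comp h2 h3)
  have hsum : Computable fun a => partialMeasure (w a) (n a + 1) := by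
    refine Computable.nat_rec (h := fun a p => (w a p.1).casesOn p.2 fun x =>
      (p.2.1 * 2 ^ x.length + 2 ^ p.2.2, p.2.2 + x.length))
      (Computable.succ.comp hn) (Computable.const (0, 0)) ?_
    have hp : Computable fun b : α × ℕ × ℕ × ℕ => b.2.2 := Computable.snd.comp Computable.snd
    exact Computable.option_casesOn
      (hw.comp Computable.fst (Computable.fst.comp Computable.snd)) hp
      (hstep.to_comp.comp (hp.comp Computable.fst) Computable.snd)
  have hle : Computable₂ fun a b : ℕ => decide (a ≤ b) := Primrec.nat_le.decide.to_comp
  refine (Computable.cond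
    (hle.comp
      (Primrec.nat_mul.to_comp.comp (Computable.fst.comp hsum) (hpow.to_comp.comp hk))
      (hpow.to_comp.comp (Computable.snd.comp hsum)))
    (hw.comp Computable.id hn) (Computable.const none)).of_eq fun a => ?_
  rw [Bool.cond_decide]
  rfl

open Nat.Partrec (Code)
open Encodable

/-- The `n`-th string enumerated at level `k` by the `e`-th program, where `n` codes an argument
and a number of steps: the value at this argument is enumerated only when the computation first
terminates. -/
def enumerate (e k n : ℕ) : Option (List Bool) :=
  bif (Code.evaln n.unpair.2 (Denumerable.ofNat Code e) (Nat.pair k n.unpair.1)).isSome then none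
  else (Code.evaln (n.unpair.2 + 1) (Denumerable.ofNat Code e) (Nat.pair k n.unpair.1)).bind decode

theorem primrec_enumerate : Primrec fun a : (ℕ × ℕ) × ℕ => enumerate a.1.1 a.1.2 a.2 := by
  have hu : Primrec fun a : (ℕ × ℕ) × ℕ => a.2.unpair := Primrec.unpair.comp Primrec.snd
  have hc : Primrec fun a : (ℕ × ℕ) × ℕ => Denumerable.ofNat Code a.1.1 :=
    (Primrec.ofNat Code).comp (Primrec.fst.comp Primrec.fst)
  have hi : Primrec fun a : (ℕ × ℕ) × ℕ => Nat.pair a.1.2 a.2.unpair.1 :=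
    Primrec₂.natPair.comp (Primrec.snd.comp Primrec.fst) (Primrec.fst.comp hu)
  have hs : Primrec fun a : (ℕ × ℕ) × ℕ => a.2.unpair.2 := Primrec.snd.comp hu
  exact Primrec.cond
    (Primrec.option_isSome.comp (Code.primrec_evaln.comp (Primrec.pair (Primrec.pair hs hc) hi)))
    (Primrec.const none)
    (Primrec.option_bind
      (Code.primrec_evaln.comp (Primrec.pair (Primrec.pair (Primrec.succ.comp hs) hc) hi))
      (Primrec.decode.comp Primrec.snd))

theorem exists_enumerate {v : ℕ → ℕ → List Bool} (hv : Computable₂ v) :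
    ∃ e, ∀ k, (∀ i, ∃ n, enumerate e k n = some (v k i)) ∧
      ∑' n, optCylMeasure (enumerate e k n) ≤ ∑' i, optCylMeasure (some (v k i)) := by
  have hpart : Nat.Partrec fun m => Part.some (encode (v m.unpair.1 m.unpair.2)) :=
    Partrec.nat_iff.1 (Computable.encode.comp
      (hv.comp (Computable.fst.comp Computable.unpair) (Computable.snd.comp Computable.unpair)))
  obtain ⟨c, hc⟩ := Code.exists_code.1 hpart
  refine ⟨encode c, fun k => ?_⟩
  have hval : ∀ i s x, x ∈ Code.evaln s c (Nat.pair k i) → x = encode (v k i) := by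
    intro i s x hx
    have := Code.evaln_sound hx
    rw [hc] at this
    simpa using this
  have hfirst : ∀ i, ∃ s, Code.evaln s c (Nat.pair k i) = none ∧
      Code.evaln (s + 1) c (Nat.pair k i) = some (encode (v k i)) := by
    intro i
    have hmem : encode (v k i) ∈ Code.eval c (Nat.pair k i) := by
      rw [hc]
      simp
    have hex := Code.evaln_complete.1 hmem
    classical
    obtain ⟨s, hs⟩ : ∃ s, Nat.find hex = s + 1 := by
      refine Nat.exists_eq_succ_of_ne_zero fun h0 => ?_
      have := Nat.find_spec hex
      rw [h0] at this
      simp [Code.evaln] at this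
    refine ⟨s, ?_, ?_⟩
    · rw [Option.eq_none_iff_forall_not_mem]
      intro x hx
      exact Nat.find_min hex (m := s) (by omega) (hval i s x hx ▸ hx)
    · rw [← hs]
      exact Nat.find_spec hex
  choose s hs0 hs1 using hfirst
  have henum : ∀ i, enumerate (encode c) k (Nat.pair i (s i)) = some (v k i) := by
    intro i
    simp [enumerate, hs0, hs1]
  refine ⟨fun i => ⟨_, henum i⟩, ?_⟩
  rw [← Nat.pairEquiv.tsum_eq, ENNReal.tsum_prod']
  refine ENNReal.tsum_le_tsum fun i => ?_
  rw [tsum_eq_single (s i)]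
  · exact (congrArg optCylMeasure (henum i)).le
  · intro t ht
    have hnone : enumerate (encode c) k (Nat.pair i t) = none := by
      simp only [enumerate, Nat.unpair_pair, Denumerable.ofNat_encode]
      rcases ht.lt_or_gt with h | h
      · have : Code.evaln (t + 1) c (Nat.pair k i) = none := by
          rw [Option.eq_none_iff_forall_not_mem]
          intro x hx
          have := Code.evaln_mono (Nat.succ_le_of_lt h) hx
          rw [hs0] at this
          simp at this
        simp [this]
      · have : Code.evaln t c (Nat.pair k i) = some (encode (v k i)) :=
          Code.evaln_mono (Nat.succ_le_of_lt h) (hs1 i)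
        simp [this]
    exact congrArg optCylMeasure hnone

/-- A computable sequence of strings which for every `K` enumerates, among others, all strings that
the `e`-th program enumerates at level `k = K + e + 2`, as long as their total measure is at most
`2 ^ (-k)`. -/
def universalCover (K t : ℕ) : List Bool :=
  (truncate (enumerate t.unpair.1 (K + t.unpair.1 + 2)) (K + t.unpair.1 + 2) t.unpair.2).getD
    (List.replicate (K + 1 + t + 1) false)

theorem computable_universalCover : Computable₂ universalCover := by
  have he : Primrec fun a : ℕ × ℕ => a.2.unpair.1 :=
    Primrec.fst.comp (Primrec.unpair.comp Primrec.snd)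
  have hk : Primrec fun a : ℕ × ℕ => a.1 + a.2.unpair.1 + 2 :=
    Primrec.nat_add.comp (Primrec.nat_add.comp Primrec.fst he) (Primrec.const 2)
  have hrep : Primrec fun a : ℕ × ℕ => List.replicate (a.1 + 1 + a.2 + 1) false := by
    refine (Primrec.list_map (Primrec.list_range.comp (Primrec.succ.comp
      (Primrec.nat_add.comp (Primrec.succ.comp Primrec.fst) Primrec.snd)))
      (Primrec.const false).to₂).of_eq fun a => ?_
    simp
  refine Computable.option_getD (Computable.truncate (w := fun (a : ℕ × ℕ) n =>
    enumerate a.2.unpair.1 (a.1 + a.2.unpair.1 + 2) n) ?_ hk.to_comp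
      (Primrec.snd.comp (Primrec.unpair.comp Primrec.snd)).to_comp) hrep.to_comp
  exact (primrec_enumerate.comp
    (Primrec.pair (Primrec.pair (he.comp Primrec.fst) (hk.comp Primrec.fst)) Primrec.snd)).to_comp

theorem tsum_universalCover_le (K : ℕ) :
    ∑' t, optCylMeasure (some (universalCover K t)) ≤ (2 ^ K)⁻¹ := by
  have h1 : ∑' t : ℕ, optCylMeasure (truncate (enumerate t.unpair.1 (K + t.unpair.1 + 2))
      (K + t.unpair.1 + 2) t.unpair.2) ≤ (2 ^ (K + 1))⁻¹ := by
    rw [← Nat.pairEquiv.tsum_eq, ENNReal.tsum_prod', ← ENNReal.tsum_inv_two_pow_add]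
    refine ENNReal.tsum_le_tsum fun e => ?_
    simp only [Nat.pairEquiv_apply, Function.uncurry_apply_pair, Nat.unpair_pair]
    rw [show K + 1 + e + 1 = K + e + 2 by omega]
    exact tsum_truncate_le _ _
  have h2 : ∑' t : ℕ, optCylMeasure (some (List.replicate (K + 1 + t + 1) false)) =
      (2 ^ (K + 1))⁻¹ := by
    simp only [optCylMeasure, Option.elim_some, List.length_replicate]
    exact ENNReal.tsum_inv_two_pow_add _
  calc ∑' t, optCylMeasure (some (universalCover K t))
      ≤ _ := ENNReal.tsum_le_tsum fun t => optCylMeasure_getD_le _ _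
    _ ≤ (2 ^ (K + 1))⁻¹ + (2 ^ (K + 1))⁻¹ := by
        rw [ENNReal.tsum_add, h2]
        gcongr
    _ = (2 ^ K)⁻¹ := by
        rw [ENNReal.inv_pow, ENNReal.inv_pow, pow_succ, ← mul_add, ENNReal.inv_two_add_inv_two,
          mul_one]

theorem exists_universalCover_eq {v : ℕ → ℕ → List Bool} (hv : Computable₂ v)
    (hsum : ∀ k, ∑' i, optCylMeasure (some (v k i)) ≤ (2 ^ k)⁻¹) (K : ℕ) :
    ∃ k, ∀ i, ∃ t, universalCover K t = v k i := by
  obtain ⟨e, he⟩ := exists_enumerate hv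
  refine ⟨K + e + 2, fun i => ?_⟩
  obtain ⟨n, hn⟩ := (he (K + e + 2)).1 i
  refine ⟨Nat.pair e n, ?_⟩
  rw [universalCover, Nat.unpair_pair, truncate_eq_self ((he _).2.trans (hsum _)), hn]
  rfl

theorem two_zpow_neg_length (x : List Bool) :
    (2 : ℝ≥0∞) ^ (-(x.length : ℤ)) = optCylMeasure (some x) := by
  simp [optCylMeasure, ENNReal.zpow_neg]

/-- There exists a maximal effectively null set. -/
theorem exists_maximal_effectively_null_set :
    ∃ N : Set (ℕ → Bool), EffNull N ∧
      ∀ X : Set (ℕ → Bool), EffNull X → X ⊆ N := by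
  refine ⟨⋂ ε : ℚ, ⋂ _ : 0 < ε, ⋃ t, Cyl (universalCover (Rat.rank ε) t),
    ⟨fun p => universalCover (Rat.rank p.1) p.2, ?_, fun ε hε => ⟨?_, ?_⟩⟩, ?_⟩
  · exact computable_universalCover.comp (Computable.encode.comp Computable.fst) Computable.snd
  · exact Set.iInter₂_subset ε hε
  · simp_rw [two_zpow_neg_length]
    refine (tsum_universalCover_le _).trans ?_
    rw [ENNReal.le_ofReal_iff_toReal_le (by simp) (by exact_mod_cast hε.le)]
    have h := Rat.inv_two_pow_rank_le hε
    simp only [ENNReal.toReal_inv, ENNReal.toReal_pow, ENNReal.toReal_ofNat]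
    calc ((2 : ℝ) ^ Rat.rank ε)⁻¹ = (((2 ^ Rat.rank ε)⁻¹ : ℚ) : ℝ) := by push_cast; rfl
      _ ≤ ε := Rat.cast_le.2 h
  · rintro X ⟨u, hu, hX⟩
    refine Set.subset_iInter₂ fun ε _ => ?_
    have hv : Computable₂ fun k i => u (((2 ^ k : ℕ) : ℚ)⁻¹, i) :=
      hu.comp (Computable.pair (Rat.primrec_inv_two_pow.to_comp.comp Computable.fst)
        Computable.snd)
    have hpos : ∀ k : ℕ, (0 : ℚ) < ((2 ^ k : ℕ) : ℚ)⁻¹ := fun k => by positivity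
    obtain ⟨k, hk⟩ := exists_universalCover_eq hv (fun k => by
      have h := (hX _ (hpos k)).2
      simp_rw [two_zpow_neg_length] at h
      refine h.trans_eq ?_
      push_cast
      rw [ENNReal.ofReal_inv_of_pos (by positivity), ENNReal.ofReal_pow (by norm_num),
        ENNReal.ofReal_ofNat]) (Rat.rank ε)
    refine (hX _ (hpos k)).1.trans (Set.iUnion_subset fun i => ?_)
    obtain ⟨t, ht⟩ := hk i
    rw [← ht]
    exact Set.subset_iUnion (fun t => Cyl (universalCover (Rat.rank ε) t)) t
end

section
/- Strong law of large numbers for Martin-Löf random sequences: if χ : ℕ → Bool is Martin-Löf random, then the frequency of ones in its prefixes converges to 1/2, i.e., lim_{n→∞} (#{i < n : χ_i = true})/n = 1/2. -/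
open scoped ENNReal
open Filter

/-- `χ` is Martin-Löf random: it belongs to no effectively null set. -/
def MLRandom (χ : ℕ → Bool) : Prop :=
  ∀ X : Set (ℕ → Bool), EffNull X → χ ∉ X

/-- The code of `a` in the denumeration built from an encoding is the rank of its original code, so
any sequence with increasing codes bounds the original code in terms of the rank. -/
theorem encode_le_encode_ofEncodableOfInfinite {α : Type*} [E : Encodable α] [Infinite α]
    (f : ℕ → α) (hf : StrictMono fun n => Encodable.encode (f n)) (a : α) :
    Encodable.encode a ≤
      Encodable.encode (f ((Denumerable.ofEncodableOfInfinite α).toEncodable.encode a)) := by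
  classical
  let s := Set.range (Encodable.encode : α → ℕ)
  let _ : DecidablePred (· ∈ s) := Encodable.decidableRangeEncode α
  have : Infinite s :=
    Infinite.of_injective _ (Equiv.ofInjective _ Encodable.encode_injective).injective
  set n := (Denumerable.ofEncodableOfInfinite α).toEncodable.encode a with hn
  have h1 : Nat.Subtype.ofNat s n = ⟨Encodable.encode a, a, rfl⟩ :=
    (Nat.Subtype.denumerable s).toEncodable.encode_injective
      ((@Denumerable.encode_ofNat s (Nat.Subtype.denumerable s) n).trans hn)
  have h2 : Nat.Subtype.orderIsoOfNat s n = ⟨Encodable.encode a, a, rfl⟩ := by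
    rw [← h1]; simp
  let g : ℕ → s := fun k => ⟨Encodable.encode (f k), f k, rfl⟩
  have hg : StrictMono fun k => (Nat.Subtype.orderIsoOfNat s).symm (g k) :=
    (Nat.Subtype.orderIsoOfNat s).symm.strictMono.comp hf
  have := (OrderIso.le_symm_apply _).1 (hg.le_apply (x := n))
  rw [h2] at this
  exact this

theorem Rat.den_le_encode (x : ℚ) : x.den ≤ Rat.instEncodable.encode x := by
  obtain ⟨a, b, hb, h⟩ := x
  exact Nat.right_le_pair _ b

theorem Rat.encode_natCast (n : ℕ) : Rat.instEncodable.encode (n : ℚ) = Nat.pair (2 * n) 1 := by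
  rfl

/-- A primitive recursive upper bound for the denominator, computed from the code of a rational in
the `Denumerable` encoding. -/
def Rat.denBound (x : ℚ) : ℕ :=
  Nat.pair (2 * Rat.instDenumerable.toEncodable.encode x) 1

theorem Rat.primrec_denBound : Primrec Rat.denBound :=
  Primrec₂.natPair.comp (Primrec.nat_mul.comp (Primrec.const 2) Primrec.encode) (Primrec.const 1)

theorem Rat.den_le_denBound (x : ℚ) : x.den ≤ x.denBound := by
  refine (Rat.den_le_encode x).trans ?_
  rw [Rat.denBound, ← Rat.encode_natCast]
  refine encode_le_encode_ofEncodableOfInfinite (fun n : ℕ => (n : ℚ)) ?_ x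
  intro a b h
  simp only [Rat.encode_natCast]
  exact Nat.pair_lt_pair_left _ (by omega)

theorem primrec_list_count (b : Bool) : Primrec (List.count b : List Bool → ℕ) := by
  refine (Primrec.list_length.comp (Primrec.listFilter
    (p := fun a : Bool => a = b) (Primrec.eq.comp Primrec.id (Primrec.const b)))).of_eq fun l => ?_
  rw [List.count_eq_length_filter]
  congr 2

theorem tsum_list_map_prod {α : Type*} [Fintype α] (g : α → ℝ≥0∞) :
    ∑' l : List α, (l.map g).prod = ∑' n : ℕ, (∑ a, g a) ^ n := by
  rw [← List.equivSigmaTuple.symm.tsum_eq, ENNReal.tsum_sigma']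
  refine tsum_congr fun n => ?_
  rw [tsum_fintype, Fintype.sum_pow]
  refine Finset.sum_congr rfl fun f _ => ?_
  simp [List.equivSigmaTuple, List.map_ofFn, List.prod_ofFn]

/-- The number of occurrences of `b` in `l` is at least `(1 / 2 + 1 / k) * l.length`. -/
def Biased (b : Bool) (k : ℕ) (l : List Bool) : Prop :=
  (k + 2) * l.length ≤ 2 * k * l.count b

instance (b : Bool) (k : ℕ) : DecidablePred (Biased b k) := fun _ => Nat.decLe _ _

/-- The letter weights of the Chernoff bound for the deviation `d`. -/
noncomputable def chernoffWeight (b : Bool) (d : ℝ) (a : Bool) : ℝ≥0∞ :=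
  2⁻¹ * ENNReal.ofReal (Real.exp ((if a = b then d else -d) - d ^ 2 + d ^ 2 / 4))

theorem sum_chernoffWeight_le (b : Bool) (d : ℝ) :
    ∑ a, chernoffWeight b d a ≤ ENNReal.ofReal (Real.exp (-(d ^ 2 / 4))) := by
  have h2 : (2⁻¹ : ℝ≥0∞) = ENNReal.ofReal (1 / 2) := by
    rw [one_div, ENNReal.ofReal_inv_of_pos two_pos]; simp
  have key : 1 / 2 * (Real.exp (d - d ^ 2 + d ^ 2 / 4) + Real.exp (-d - d ^ 2 + d ^ 2 / 4)) ≤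
      Real.exp (-(d ^ 2 / 4)) := by
    have h := mul_le_mul_of_nonneg_right (Real.cosh_le_exp_half_sq d)
      (Real.exp_pos (-d ^ 2 + d ^ 2 / 4)).le
    rw [Real.cosh_eq, ← Real.exp_add] at h
    calc _ = (Real.exp d + Real.exp (-d)) / 2 * Real.exp (-d ^ 2 + d ^ 2 / 4) := by
          rw [show d - d ^ 2 + d ^ 2 / 4 = d + (-d ^ 2 + d ^ 2 / 4) by ring,
            show -d - d ^ 2 + d ^ 2 / 4 = -d + (-d ^ 2 + d ^ 2 / 4) by ring,
            Real.exp_add d, Real.exp_add (-d)]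
          ring
      _ ≤ _ := h
      _ = _ := by congr 1; ring
  refine le_trans (le_of_eq ?_) (ENNReal.ofReal_le_ofReal key)
  rw [ENNReal.ofReal_mul (by norm_num), ENNReal.ofReal_add (Real.exp_pos _).le (Real.exp_pos _).le,
    ← h2]
  cases b <;> simp [chernoffWeight, mul_add, add_comm]

theorem prod_map_chernoffWeight (b : Bool) (d : ℝ) (l : List Bool) :
    (l.map (chernoffWeight b d)).prod = 2⁻¹ ^ l.length *
      ENNReal.ofReal (Real.exp (d * (2 * l.count b - l.length) - d ^ 2 * l.length +
        d ^ 2 / 4 * l.length)) := by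
  induction l with
  | nil => simp
  | cons a l ih =>
    rw [List.map_cons, List.prod_cons, ih, chernoffWeight, mul_mul_mul_comm,
      ← ENNReal.ofReal_mul (Real.exp_pos _).le, ← Real.exp_add, List.length_cons, pow_succ' _ l.length]
    congr 3
    by_cases h : a = b
    · rw [if_pos h, h, List.count_cons_self]; push_cast; ring
    · rw [if_neg h, List.count_cons_of_ne h]; push_cast; ring

theorem tsum_biased_le (b : Bool) {k : ℕ} (hk : 0 < k) {d : ℝ} (hd : d = 2 / k) (N : ℕ) :
    ∑' l : List Bool, (if N ≤ l.length ∧ Biased b k l then (2⁻¹ : ℝ≥0∞) ^ l.length else 0) ≤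
      ENNReal.ofReal (Real.exp (-(d ^ 2 / 4))) ^ N *
        (1 - ENNReal.ofReal (Real.exp (-(d ^ 2 / 4))))⁻¹ := by
  calc _ ≤ ∑' l : List Bool, ENNReal.ofReal (Real.exp (-(d ^ 2 / 4))) ^ N *
        (l.map (chernoffWeight b d)).prod := by
        refine ENNReal.tsum_le_tsum fun l => ?_
        split_ifs with h
        · obtain ⟨hN, hb⟩ := h
          rw [prod_map_chernoffWeight, mul_left_comm, ← ENNReal.ofReal_pow (Real.exp_pos _).le,
            ← ENNReal.ofReal_mul (by positivity), ← Real.exp_nat_mul, ← Real.exp_add]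
          refine le_mul_of_one_le_right' ?_
          rw [← ENNReal.ofReal_one]
          refine ENNReal.ofReal_le_ofReal (Real.one_le_exp ?_)
          have hk' : (0 : ℝ) < k := Nat.cast_pos.2 hk
          have hb' : ((k : ℝ) + 2) * l.length ≤ 2 * k * l.count b := by exact_mod_cast hb
          have hN' : (N : ℝ) ≤ l.length := by exact_mod_cast hN
          have hd0 : 0 < d := hd ▸ by positivity
          have h1 : d * l.length ≤ 2 * l.count b - l.length := by
            rw [hd, div_mul_eq_mul_div, div_le_iff₀ hk']; linarith
          nlinarith [mul_le_mul_of_nonneg_left h1 hd0.le,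
            mul_le_mul_of_nonneg_left hN' (sq_nonneg d)]
        · exact zero_le
    _ ≤ _ := by
        rw [ENNReal.tsum_mul_left, tsum_list_map_prod, ← ENNReal.tsum_geometric]
        gcongr
        exact sum_chernoffWeight_le b d

theorem exists_tsum_biased_le (b : Bool) {k : ℕ} (hk : 0 < k) :
    ∃ K : ℕ, ∀ m : ℕ, ∑' l : List Bool,
      (if K * (m + 1) ≤ l.length ∧ Biased b k l then (2⁻¹ : ℝ≥0∞) ^ l.length else 0) ≤
        2⁻¹ ^ (m + 1) := by
  set d : ℝ := 2 / k with hd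
  set q := ENNReal.ofReal (Real.exp (-(d ^ 2 / 4))) with hq
  have hd0 : 0 < d := by positivity
  have hq1 : q < 1 := by
    rw [hq, ← ENNReal.ofReal_one]
    exact (ENNReal.ofReal_lt_ofReal_iff one_pos).2
      (Real.exp_lt_one_iff.2 (by nlinarith [sq_pos_of_pos hd0]))
  have hC : (1 - q)⁻¹ ≠ ∞ := ENNReal.inv_ne_top.2 (tsub_pos_of_lt hq1).ne'
  have hC1 : 1 ≤ (1 - q)⁻¹ := ENNReal.one_le_inv.2 tsub_le_self
  obtain ⟨K, hK⟩ : ∃ K : ℕ, q ^ K * (1 - q)⁻¹ ≤ 2⁻¹ := by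
    have ht : Tendsto (fun n : ℕ => q ^ n * (1 - q)⁻¹) atTop (nhds (0 * (1 - q)⁻¹)) :=
      ENNReal.Tendsto.mul_const (ENNReal.tendsto_pow_atTop_nhds_zero_of_lt_one hq1) (Or.inr hC)
    rw [zero_mul] at ht
    exact ((ht.eventually_le_const (by simp : (0 : ℝ≥0∞) < 2⁻¹)).exists)
  refine ⟨K, fun m => (tsum_biased_le b hk hd _).trans ?_⟩
  calc q ^ (K * (m + 1)) * (1 - q)⁻¹ ≤ (q ^ K) ^ (m + 1) * (1 - q)⁻¹ ^ (m + 1) := by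
        rw [pow_mul]
        gcongr
        exact le_self_pow₀ hC1 (by omega)
    _ = (q ^ K * (1 - q)⁻¹) ^ (m + 1) := (mul_pow _ _ _).symm
    _ ≤ _ := by gcongr

/-- Enumerates the biased lists of length at least `K * (m + 1)`, where `m = p.1.denBound`, together
with padding of total weight `2 ^ (-(m + 1))`. -/
def biasedCover (b : Bool) (k K : ℕ) (p : ℚ × ℕ) : List Bool :=
  if Encodable.encode ((Encodable.decode (α := List Bool) p.2).getD []) = p.2 ∧
      K * (p.1.denBound + 1) ≤
        ((Encodable.decode (α := List Bool) p.2).getD []).length ∧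
      Biased b k ((Encodable.decode (α := List Bool) p.2).getD []) then
    (Encodable.decode (α := List Bool) p.2).getD []
  else
    List.replicate (p.2 + p.1.denBound + 2) false

theorem primrec_list_replicate {α : Type*} [Primcodable α] (a : α) :
    Primrec fun n : ℕ => List.replicate n a :=
  (Primrec.list_map Primrec.list_range ((Primrec.const a).to₂ (α := ℕ) (β := ℕ))).of_eq
    fun n => by simp

theorem primrec_biasedCover (b : Bool) (k K : ℕ) : Primrec (biasedCover b k K) := by
  have hl : Primrec fun p : ℚ × ℕ => (Encodable.decode (α := List Bool) p.2).getD [] :=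
    Primrec.option_getD.comp (Primrec.decode.comp Primrec.snd) (Primrec.const [])
  have hm : Primrec fun p : ℚ × ℕ => p.1.denBound := Rat.primrec_denBound.comp Primrec.fst
  have hlen := Primrec.list_length.comp hl
  refine Primrec.ite ?_ hl ((primrec_list_replicate false).comp
    (Primrec.nat_add.comp (Primrec.nat_add.comp Primrec.snd hm) (Primrec.const 2)))
  refine (Primrec.eq.comp (Primrec.encode.comp hl) Primrec.snd).and
    ((Primrec.nat_le.comp (Primrec.nat_mul.comp (Primrec.const K) (Primrec.succ.comp hm))
      hlen).and (Primrec.nat_le.comp (Primrec.nat_mul.comp (Primrec.const (k + 2)) hlen)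
        (Primrec.nat_mul.comp (Primrec.const (2 * k)) ((primrec_list_count b).comp hl))))

theorem biasedCover_encode {b : Bool} {k K : ℕ} {ε : ℚ} {l : List Bool}
    (hl : K * (ε.denBound + 1) ≤ l.length) (hb : Biased b k l) :
    biasedCover b k K (ε, Encodable.encode l) = l := by
  simp [biasedCover, hl, hb]

theorem two_inv_pow_le_ofReal {ε : ℚ} (hε : 0 < ε) {m : ℕ} (hm : ε.den ≤ m) :
    (2⁻¹ : ℝ≥0∞) ^ m ≤ ENNReal.ofReal ε := by
  have h2 : (2⁻¹ : ℝ≥0∞) = ENNReal.ofReal 2⁻¹ := by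
    rw [ENNReal.ofReal_inv_of_pos two_pos]; simp
  rw [h2, ← ENNReal.ofReal_pow (by norm_num)]
  refine ENNReal.ofReal_le_ofReal ?_
  have hden : (0 : ℝ) < ε.den := by exact_mod_cast ε.den_pos
  have h1 : (ε.den : ℝ) ≤ 2 ^ m := by exact_mod_cast hm.trans Nat.lt_two_pow_self.le
  have h3 : (1 : ℝ) ≤ ε.num := by exact_mod_cast Rat.num_pos.2 hε
  rw [inv_pow, Rat.cast_def, ← one_div]
  exact div_le_div₀ (by linarith) h3 hden h1

theorem tsum_biasedCover_le (b : Bool) {k K : ℕ}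
    (hK : ∀ m : ℕ, ∑' l : List Bool,
      (if K * (m + 1) ≤ l.length ∧ Biased b k l then (2⁻¹ : ℝ≥0∞) ^ l.length else 0) ≤
        2⁻¹ ^ (m + 1)) {ε : ℚ} (hε : 0 < ε) :
    ∑' i : ℕ, (2⁻¹ : ℝ≥0∞) ^ (biasedCover b k K (ε, i)).length ≤ ENNReal.ofReal ε := by
  set m := ε.denBound with hm
  set W : List Bool → ℝ≥0∞ := fun l =>
    if K * (m + 1) ≤ l.length ∧ Biased b k l then (2⁻¹ : ℝ≥0∞) ^ l.length else 0 with hW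
  have hterm : ∀ i : ℕ, (2⁻¹ : ℝ≥0∞) ^ (biasedCover b k K (ε, i)).length ≤
      (∑' l : List Bool, if i = Encodable.encode l then W l else 0) + 2⁻¹ ^ (m + 2) * 2⁻¹ ^ i := by
    intro i
    rw [biasedCover]
    split_ifs with h
    · refine le_trans ?_ le_self_add
      refine le_trans ?_ (ENNReal.le_tsum ((Encodable.decode (α := List Bool) i).getD []))
      rw [if_pos h.1.symm, hW]
      exact (if_pos h.2).ge
    · refine le_trans (le_of_eq ?_) le_add_self
      rw [List.length_replicate, ← pow_add]
      congr 1
      dsimp only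
      omega
  calc _ ≤ ∑' i : ℕ, ((∑' l : List Bool, if i = Encodable.encode l then W l else 0) +
        2⁻¹ ^ (m + 2) * 2⁻¹ ^ i) := ENNReal.tsum_le_tsum hterm
    _ = ∑' l, W l + 2⁻¹ ^ (m + 2) * 2 := by
        rw [ENNReal.tsum_add, ENNReal.tsum_comm, ENNReal.tsum_mul_left, ENNReal.tsum_geometric]
        simp only [tsum_ite_eq, ENNReal.one_sub_inv_two, inv_inv]
    _ ≤ 2⁻¹ ^ (m + 1) + 2⁻¹ ^ (m + 1) := by
        refine add_le_add (hK m) (le_of_eq ?_)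
        rw [pow_succ _ (m + 1), mul_assoc, ENNReal.inv_mul_cancel two_ne_zero ENNReal.ofNat_ne_top,
          mul_one]
    _ = 2⁻¹ ^ m := by
        rw [pow_succ, ← mul_add, ENNReal.inv_two_add_inv_two, mul_one]
    _ ≤ _ := two_inv_pow_le_ofReal hε (Rat.den_le_denBound ε)

theorem mem_cyl_map_range (χ : ℕ → Bool) (n : ℕ) : χ ∈ Cyl ((List.range n).map χ) := by
  intro i
  simp

theorem effNull_frequently_biased (b : Bool) {k : ℕ} (hk : 0 < k) :
    EffNull {χ | ∃ᶠ n in atTop, Biased b k ((List.range n).map χ)} := by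
  obtain ⟨K, hK⟩ := exists_tsum_biased_le b hk
  refine ⟨biasedCover b k K, (primrec_biasedCover b k K).to_comp, fun ε hε => ⟨?_, ?_⟩⟩
  · intro χ hχ
    obtain ⟨n, hn, hb⟩ := frequently_atTop.1 hχ (K * (ε.denBound + 1))
    refine Set.mem_iUnion.2 ⟨Encodable.encode ((List.range n).map χ), ?_⟩
    rw [biasedCover_encode (by simpa using hn) hb]
    exact mem_cyl_map_range χ n
  · simpa [ENNReal.zpow_neg, ENNReal.inv_pow] using tsum_biasedCover_le b hK hε

theorem MLRandom.eventually_count_lt {χ : ℕ → Bool} (hχ : MLRandom χ) (b : Bool) {k : ℕ}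
    (hk : 0 < k) :
    ∀ᶠ n in atTop, 2 * k * ((List.range n).map χ).count b < (k + 2) * n := by
  have h := hχ _ (effNull_frequently_biased b hk)
  rw [Set.mem_ofPred_eq, not_frequently] at h
  filter_upwards [h] with n hn
  simpa [Biased] using hn

theorem count_map_range (χ : ℕ → Bool) (b : Bool) (n : ℕ) :
    ((List.range n).map χ).count b = ((Finset.range n).filter fun i => χ i = b).card := by
  induction n with
  | zero => simp
  | succ n ih =>
    rw [List.range_succ, List.map_append, List.count_append, ih, Finset.range_add_one,
      Finset.filter_insert]
    by_cases h : χ n = b <;> simp [h]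

/-- Strong law of large numbers for Martin-Löf random sequences: the frequency
of ones in the prefixes of a Martin-Löf random sequence tends to `1/2`. -/
theorem mlrandom_frequency_one_half
    (χ : ℕ → Bool) (hχ : MLRandom χ) :
    Tendsto
      (fun n : ℕ =>
        (((Finset.range n).filter (fun i => χ i = true)).card : ℝ) / n)
      atTop (nhds (1 / 2)) := by
  rw [Metric.tendsto_nhds]
  intro ε hε
  obtain ⟨j, hj⟩ := exists_nat_one_div_lt hε
  filter_upwards [hχ.eventually_count_lt true j.succ_pos, hχ.eventually_count_lt false j.succ_pos,
    eventually_gt_atTop 0] with n ht hf hn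
  have hsum : ((List.range n).map χ).count true + ((List.range n).map χ).count false = n := by
    rw [List.count_true_add_count_false]; simp
  rw [← count_map_range]
  generalize ((List.range n).map χ).count true = c at *
  generalize ((List.range n).map χ).count false = e at *
  have hn' : (0 : ℝ) < n := Nat.cast_pos.2 hn
  have hj' : (0 : ℝ) < j + 1 := by positivity
  have hsum' : (c : ℝ) + e = n := by exact_mod_cast hsum
  have ht' : 2 * ((j : ℝ) + 1) * c < (j + 1 + 2) * n := by exact_mod_cast ht
  have hf' : 2 * ((j : ℝ) + 1) * e < (j + 1 + 2) * n := by exact_mod_cast hf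
  have he : (e : ℝ) = n - c := by linarith
  rw [he] at hf'
  refine lt_trans ?_ hj
  rw [Real.dist_eq, abs_lt]
  constructor
  · rw [← sub_pos]
    have : (c : ℝ) / n - 1 / 2 - -(1 / (j + 1)) =
        ((j + 1 + 2) * n - 2 * (j + 1) * (n - c)) / (2 * (j + 1) * n) := by
      field_simp; ring
    rw [this]
    exact div_pos (by linarith) (by positivity)
  · rw [← sub_pos]
    have : 1 / ((j : ℝ) + 1) - (c / n - 1 / 2) =
        ((j + 1 + 2) * n - 2 * (j + 1) * c) / (2 * (j + 1) * n) := by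
      field_simp; ring
    rw [this]
    exact div_pos (by linarith) (by positivity)
end
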